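/- Let F be a field of characteristic different from two, let p and q be forms over F, and let π be an n-fold Pfister form over F. If q is hyperbolic over F(p), then π ⊗ q is hyperbolic over F(π ⊗ p). -/

import Mathlib

set_option synthInstance.maxHeartbeats 1000000
set_option maxHeartbeats 4000000

open scoped BigOperators Classical

namespace QF

section Defs

variable {R : Type*} [CommRing R]

/-- Evaluation of the diagonal quadratic form with coefficients `d` at the vector `v`. -/
def evalQF {n : ℕ} (d : Fin n → R) (v : Fin n → R) : R := ∑ i, d i * v i ^ 2

/-- A form is isotropic if it represents zero non-trivially. -/
def Isotropic {n : ℕ} (d : Fin n → R) : Prop := ∃ v : Fin n → R, v ≠ 0 ∧ evalQF d v = 0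

def Anisotropic {n : ℕ} (d : Fin n → R) : Prop := ¬ Isotropic d

/-- Nondegeneracy of a diagonal form: all coefficients are nonzero. -/
def Nondeg {n : ℕ} (d : Fin n → R) : Prop := ∀ i, d i ≠ 0

/-- Two diagonal forms are isometric if a linear equivalence matches their values. -/
def Isometric {m n : ℕ} (d : Fin m → R) (e : Fin n → R) : Prop :=
  ∃ φ : (Fin m → R) ≃ₗ[R] (Fin n → R), ∀ v, evalQF e (φ v) = evalQF d v

/-- Orthogonal sum of diagonal forms. -/
def osum {m n : ℕ} (d : Fin m → R) (e : Fin n → R) : Fin (m + n) → R := Fin.append d e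

/-- Tensor product of diagonal forms. -/
def tensorQF {m n : ℕ} (d : Fin m → R) (e : Fin n → R) : Fin (m * n) → R :=
  fun i => d (finProdFinEquiv.symm i).1 * e (finProdFinEquiv.symm i).2

/-- Scaling of a form by a scalar. -/
def smulQF {n : ℕ} (a : R) (d : Fin n → R) : Fin n → R := fun i => a * d i

/-- `k` copies of the hyperbolic plane `⟨1,-1⟩`. -/
def hypform {R : Type*} [CommRing R] (k : ℕ) : Fin (k + k) → R :=
  Fin.append (fun _ => 1) (fun _ => -1)

/-- A form is hyperbolic if it is isometric to a sum of hyperbolic planes,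
i.e. its Witt index is half its dimension. -/
def IsHyperbolic {n : ℕ} (d : Fin n → R) : Prop := ∃ k : ℕ, Isometric d (hypform k)

/-- The Witt index: the largest `k` such that `d ≅ k×⟨1,-1⟩ ⊥ r`. -/
noncomputable def WittIndex {n : ℕ} (d : Fin n → R) : ℕ :=
  sSup {k : ℕ | ∃ (m : ℕ) (r : Fin m → R), Isometric d (osum (hypform k) r)}

/-- `r` is a subform of `d`: `d ≅ r ⊥ s` for some (nondegenerate) form `s`. -/
def Subform {m n : ℕ} (r : Fin m → R) (d : Fin n → R) : Prop :=
  ∃ (k : ℕ) (s : Fin k → R), Nondeg s ∧ Isometric d (osum r s)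

/-- The set of nonzero represented values. -/
def Dset {n : ℕ} (d : Fin n → R) : Set R :=
  {a | a ≠ 0 ∧ ∃ v : Fin n → R, evalQF d v = a}

/-- The group of similarity factors `G(q) = {a : a·q ≅ q}`. -/
def Gset {n : ℕ} (d : Fin n → R) : Set R :=
  {a | a ≠ 0 ∧ Isometric (smulQF a d) d}

/-- `H(q) = {a : ⟨1,-a⟩ ⊗ q is isotropic}`. -/
def Hset {n : ℕ} (d : Fin n → R) : Set R :=
  {a | a ≠ 0 ∧ Isotropic (tensorQF ![1, -a] d)}

/-- Base change of a form along a ring homomorphism (e.g. a field extension). -/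
def bc {S : Type*} [CommRing S] (f : R →+* S) {n : ℕ} (d : Fin n → R) : Fin n → S :=
  fun i => f (d i)

/-- The Pfister form `⟨1,a 0⟩ ⊗ ⋯ ⊗ ⟨1, a (n-1)⟩`: its `2^n` diagonal coefficients are
the products `∏_{j ∈ S} a j` over subsets `S` of the index set. -/
noncomputable def pfisterOf {n : ℕ} (a : Fin n → R) : Fin (2 ^ n) → R :=
  fun i => ∏ j : Fin n, if (finFunctionFinEquiv.symm i) j = 0 then 1 else a j

/-- `π` is an `n`-fold Pfister form. -/
def IsNPfister (n : ℕ) {m : ℕ} (π : Fin m → R) : Prop :=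
  ∃ a : Fin n → R, (∀ i, a i ≠ 0) ∧ Isometric π (pfisterOf a)

/-- `π` is a Pfister form. -/
def IsPfister {m : ℕ} (π : Fin m → R) : Prop := ∃ n : ℕ, IsNPfister n π

end Defs

/-- The quadric polynomial `p(X₁,…,Xₙ) = ∑ dᵢ Xᵢ²` attached to a diagonal form. -/
noncomputable def formPoly {F : Type*} [CommRing F] {n : ℕ} (d : Fin n → F) :
    MvPolynomial (Fin n) F :=
  ∑ i, MvPolynomial.C (d i) * MvPolynomial.X i ^ 2

/-- The affine coordinate ring `F[X₁,…,Xₙ]/(p(X))` of the quadric `p = 0`. -/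
abbrev CoordRing {F : Type*} [CommRing F] {n : ℕ} (d : Fin n → F) : Type _ :=
  MvPolynomial (Fin n) F ⧸ Ideal.span {formPoly d}

/-- The function field `F(p)` of the quadric `p = 0`: the total fraction ring of the
coordinate ring (the quotient field when the coordinate ring is a domain, i.e. when `p` is
anisotropic of dimension at least 2). -/
abbrev FunField {F : Type*} [Field F] {n : ℕ} (d : Fin n → F) : Type _ :=
  FractionRing (CoordRing d)

end QF

namespace QF

open Matrix

section MatrixForms

variable {R S : Type*} [CommRing R] [CommRing S]
variable {ι κ μ ν : Type} [Fintype ι] [Fintype κ] [Fintype μ] [Fintype ν]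
  [DecidableEq ι] [DecidableEq κ] [DecidableEq μ] [DecidableEq ν]

/-- Isometry of diagonal forms with arbitrary finite index types, witnessed by an invertible
matrix. Unlike `Isometric`, this visibly commutes with base change. -/
def FormIso (d : ι → R) (e : κ → R) : Prop :=
  ∃ (M : Matrix κ ι R) (N : Matrix ι κ R),
    N * M = 1 ∧ M * N = 1 ∧ Mᵀ * diagonal e * M = diagonal d

/-- The sum of hyperbolic planes indexed by `κ`. -/
def hypPlanes (R : Type*) [CommRing R] (κ : Type) : κ ⊕ κ → R := Sum.elim (fun _ => 1) (fun _ => -1)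

/-- Tensor product of diagonal forms, indexed by the product. -/
def formMul (d : ι → R) (e : κ → R) : ι × κ → R := fun x => d x.1 * e x.2

/-- Hyperbolicity of a diagonal form, in terms of `FormIso`. -/
def Hyp (d : ι → R) : Prop := ∃ k : ℕ, FormIso d (hypPlanes R (Fin k))

theorem FormIso.refl (d : ι → R) : FormIso d d := ⟨1, 1, by simp, by simp, by simp⟩

theorem FormIso.symm {d : ι → R} {e : κ → R} (h : FormIso d e) : FormIso e d := by
  obtain ⟨M, N, h1, h2, h3⟩ := h
  refine ⟨N, M, h2, h1, ?_⟩
  rw [← h3]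
  calc Nᵀ * (Mᵀ * diagonal e * M) * N = (M * N)ᵀ * diagonal e * (M * N) := by
        simp only [transpose_mul, Matrix.mul_assoc]
    _ = diagonal e := by simp [h2]

theorem FormIso.trans {d : ι → R} {e : κ → R} {f : μ → R} (h : FormIso d e) (h' : FormIso e f) :
    FormIso d f := by
  obtain ⟨M, N, h1, h2, h3⟩ := h
  obtain ⟨M', N', h1', h2', h3'⟩ := h'
  refine ⟨M' * M, N * N', ?_, ?_, ?_⟩
  · calc N * N' * (M' * M) = N * (N' * M') * M := by simp only [Matrix.mul_assoc]
      _ = 1 := by simp [h1', h1]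
  · calc M' * M * (N * N') = M' * (M * N) * N' := by simp only [Matrix.mul_assoc]
      _ = 1 := by simp [h2', h2]
  · rw [← h3, ← h3']
    simp only [transpose_mul, Matrix.mul_assoc]

theorem FormIso.map (f : R →+* S) {d : ι → R} {e : κ → R} (h : FormIso d e) :
    FormIso (fun i => f (d i)) (fun i => f (e i)) := by
  obtain ⟨M, N, h1, h2, h3⟩ := h
  refine ⟨M.map f, N.map f, ?_, ?_, ?_⟩
  · rw [← Matrix.map_mul, h1]; simp
  · rw [← Matrix.map_mul, h2]; simp
  · have := congrArg (fun X => X.map f) h3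
    simpa [Matrix.map_mul, transpose_map, diagonal_map] using this

theorem FormIso.sum {d : ι → R} {e : κ → R} {d' : μ → R} {e' : ν → R} (h : FormIso d e)
    (h' : FormIso d' e') : FormIso (Sum.elim d d') (Sum.elim e e') := by
  obtain ⟨M, N, h1, h2, h3⟩ := h
  obtain ⟨M', N', h1', h2', h3'⟩ := h'
  refine ⟨fromBlocks M 0 0 M', fromBlocks N 0 0 N', ?_, ?_, ?_⟩
  · simp [fromBlocks_multiply, h1, h1']
  · simp [fromBlocks_multiply, h2, h2']
  · rw [← fromBlocks_diagonal, ← fromBlocks_diagonal, fromBlocks_transpose, fromBlocks_multiply,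
      fromBlocks_multiply]
    simp [h3, h3']

theorem FormIso.mul_right {d : ι → R} {e : κ → R} (h : FormIso d e) (f : μ → R) :
    FormIso (formMul d f) (formMul e f) := by
  obtain ⟨M, N, h1, h2, h3⟩ := h
  have key (d : ι → R) : diagonal (formMul d f) = kroneckerMap (· * ·) (diagonal d) (diagonal f) :=
    (diagonal_kronecker_diagonal d f).symm
  have key' (d : κ → R) : diagonal (formMul d f) = kroneckerMap (· * ·) (diagonal d) (diagonal f) :=
    (diagonal_kronecker_diagonal d f).symm
  refine ⟨kroneckerMap (· * ·) M 1, kroneckerMap (· * ·) N 1, ?_, ?_, ?_⟩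
  · rw [← mul_kronecker_mul, h1]; simp
  · rw [← mul_kronecker_mul, h2]; simp
  · rw [key, key', ← kroneckerMap_transpose, ← mul_kronecker_mul, ← mul_kronecker_mul, h3]
    simp

theorem FormIso.reindex (d : ι → R) (σ : κ ≃ ι) : FormIso (d ∘ σ) d := by
  have h1 : (1 : Matrix ι ι R).submatrix σ id * (1 : Matrix ι ι R).submatrix id σ = 1 := by
    ext i j
    simp [Matrix.mul_apply, Matrix.one_apply]
  have h2 : (1 : Matrix ι ι R).submatrix id σ * (1 : Matrix ι ι R).submatrix σ id = 1 := by
    rw [submatrix_mul_equiv]; simp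
  refine ⟨(1 : Matrix ι ι R).submatrix id σ, (1 : Matrix ι ι R).submatrix σ id, h1, h2, ?_⟩
  ext i j
  by_cases h : i = j <;>
    simp [Matrix.mul_apply, diagonal_apply, Matrix.one_apply, h, eq_comm]

theorem FormIso.mul_comm (d : ι → R) (e : κ → R) : FormIso (formMul d e) (formMul e d) := by
  convert FormIso.reindex (formMul e d) (Equiv.prodComm ι κ) using 1
  ext x; simp [formMul, _root_.mul_comm]

theorem FormIso.mul_left {d : ι → R} {e : κ → R} (f : μ → R) (h : FormIso d e) :
    FormIso (formMul f d) (formMul f e) :=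
  (FormIso.mul_comm f d).trans ((h.mul_right f).trans (FormIso.mul_comm e f))

theorem Hyp.of_iso {d : ι → R} {e : κ → R} (h : FormIso d e) (he : Hyp e) : Hyp d := by
  obtain ⟨k, hk⟩ := he
  exact ⟨k, h.trans hk⟩

theorem hyp_hypPlanes : Hyp (hypPlanes R κ) := by
  refine ⟨Fintype.card κ, ?_⟩
  convert FormIso.reindex (hypPlanes R (Fin (Fintype.card κ)))
    ((Fintype.equivFin κ).sumCongr (Fintype.equivFin κ)) using 1
  ext x; cases x <;> rfl

theorem Hyp.map (f : R →+* S) {d : ι → R} (h : Hyp d) : Hyp (fun i => f (d i)) := by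
  obtain ⟨k, hk⟩ := h
  refine ⟨k, ?_⟩
  convert hk.map f using 1
  ext x; cases x <;> simp [hypPlanes]

/-- Scaling hyperbolic planes by units yields hyperbolic planes. -/
theorem formIso_scaled_planes {h : R} (h2 : 2 * h = 1) (a b : κ → R) (hab : ∀ i, a i * b i = 1) :
    FormIso (Sum.elim a (fun i => - a i)) (hypPlanes R κ) := by
  have inv (a b : κ → R) (hab : ∀ i, a i * b i = 1) :
      fromBlocks (diagonal fun i => h * (b i + 1)) (diagonal fun i => h * (1 - b i))
        (diagonal fun i => h * (1 - b i)) (diagonal fun i => h * (b i + 1)) *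
      fromBlocks (diagonal fun i => h * (a i + 1)) (diagonal fun i => h * (1 - a i))
        (diagonal fun i => h * (1 - a i)) (diagonal fun i => h * (a i + 1)) = 1 := by
    simp only [fromBlocks_multiply, diagonal_mul_diagonal, diagonal_add]
    rw [← fromBlocks_one]
    congr 1
    · rw [← diagonal_one]; congr 1; ext i
      linear_combination (2 * h ^ 2) * hab i + (1 + 2 * h) * h2
    · rw [← diagonal_zero]; congr 1; ext i
      linear_combination (-2 * h ^ 2) * hab i
    · rw [← diagonal_zero]; congr 1; ext i
      linear_combination (-2 * h ^ 2) * hab i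
    · rw [← diagonal_one]; congr 1; ext i
      linear_combination (2 * h ^ 2) * hab i + (1 + 2 * h) * h2
  refine ⟨_, _, inv a b hab, inv b a fun i => by rw [_root_.mul_comm, hab i], ?_⟩
  rw [hypPlanes, ← fromBlocks_diagonal, ← fromBlocks_diagonal, fromBlocks_transpose,
    fromBlocks_multiply, fromBlocks_multiply]
  simp only [diagonal_transpose, diagonal_mul_diagonal, diagonal_add, Matrix.mul_zero,
    add_zero, zero_add]
  congr 1
  · congr 1; ext i
    linear_combination (a i * (1 + 2 * h)) * h2
  · rw [← diagonal_zero]; congr 1; ext i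
    ring
  · rw [← diagonal_zero]; congr 1; ext i
    ring
  · congr 1; ext i
    linear_combination (-a i * (1 + 2 * h)) * h2

/-- The tensor product of a form with unit coefficients and a hyperbolic form is hyperbolic. -/
theorem Hyp.mul_left {h : R} (h2 : 2 * h = 1) (a : μ → R) (ha : ∀ i, IsUnit (a i)) {d : ι → R}
    (hd : Hyp d) : Hyp (formMul a d) := by
  obtain ⟨k, hk⟩ := hd
  refine Hyp.of_iso (hk.mul_left a) ?_
  choose b hb using fun i => (ha i).exists_right_inv
  refine Hyp.of_iso ?_ (hyp_hypPlanes (κ := μ × Fin k))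
  refine FormIso.trans ?_ (formIso_scaled_planes h2 (fun x => a x.1) (fun x => b x.1)
    fun x => hb x.1)
  convert FormIso.reindex (Sum.elim (fun x : μ × Fin k => a x.1) (fun x => - a x.1))
    (Equiv.prodSumDistrib μ (Fin k) (Fin k)) using 1
  ext ⟨i, j | j⟩ <;> simp [formMul, hypPlanes]

end MatrixForms

end QF

namespace QF

open Matrix

section QuadraticValues

variable {R : Type*} [CommRing R]
variable {ι κ : Type} [Fintype ι] [Fintype κ]

/-- The value of the diagonal form `d` at `v`, over an arbitrary finite index type. -/
def qval (d : ι → R) (v : ι → R) : R := ∑ i, d i * v i ^ 2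

/-- The symmetric bilinear form with `bval d v v = qval d v`. -/
def bval (d : ι → R) (u v : ι → R) : R := ∑ i, d i * u i * v i

theorem qval_add (d u v : ι → R) : qval d (u + v) = qval d u + qval d v + 2 * bval d u v := by
  simp only [qval, bval, Finset.mul_sum, ← Finset.sum_add_distrib, Pi.add_apply]
  exact Finset.sum_congr rfl fun i _ => by ring

theorem qval_smul (d : ι → R) (c : R) (v : ι → R) : qval d (c • v) = c ^ 2 * qval d v := by
  simp only [qval, Finset.mul_sum, Pi.smul_apply, smul_eq_mul]
  exact Finset.sum_congr rfl fun i _ => by ring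

theorem bval_comm (d u v : ι → R) : bval d u v = bval d v u :=
  Finset.sum_congr rfl fun i _ => by ring

theorem bval_self (d v : ι → R) : bval d v v = qval d v :=
  Finset.sum_congr rfl fun i _ => by ring

theorem bval_add_right (d u v w : ι → R) : bval d u (v + w) = bval d u v + bval d u w := by
  simp only [bval, ← Finset.sum_add_distrib, Pi.add_apply]
  exact Finset.sum_congr rfl fun i _ => by ring

theorem bval_smul_right (d : ι → R) (c : R) (u v : ι → R) :
    bval d u (c • v) = c * bval d u v := by
  simp only [bval, Finset.mul_sum, Pi.smul_apply, smul_eq_mul]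
  exact Finset.sum_congr rfl fun i _ => by ring

variable [DecidableEq ι] [DecidableEq κ]

theorem bval_single (d u : ι → R) (i : ι) : bval d u (Pi.single i 1) = d i * u i := by
  simp [bval, Pi.single_apply]

theorem bval_mulVec {T : Matrix κ ι R} {d : ι → R} {e : κ → R} {α : R}
    (h : Tᵀ * diagonal e * T = α • diagonal d) (u v : ι → R) :
    bval e (T *ᵥ u) (T *ᵥ v) = α * bval d u v := by
  have aux {μ : Type} [Fintype μ] [DecidableEq μ] (f u v : μ → R) :
      bval f u v = u ⬝ᵥ (diagonal f *ᵥ v) := by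
    simp only [bval, dotProduct, mulVec_diagonal]
    exact Finset.sum_congr rfl fun i _ => by ring
  rw [aux, aux, mulVec_mulVec, ← vecMul_transpose, ← dotProduct_mulVec, mulVec_mulVec,
    ← Matrix.mul_assoc, h, smul_mulVec, dotProduct_smul, smul_eq_mul]

theorem qval_mulVec {T : Matrix κ ι R} {d : ι → R} {e : κ → R} {α : R}
    (h : Tᵀ * diagonal e * T = α • diagonal d) (v : ι → R) :
    qval e (T *ᵥ v) = α * qval d v := by
  rw [← bval_self, bval_mulVec h, bval_self]

/-- Polarization: a matrix scaling the values of a form scales its Gram matrix. -/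
theorem gram_of_qval (h2 : IsUnit (2 : R)) {T : Matrix κ ι R} {d : ι → R} {e : κ → R} {α : R}
    (h : ∀ v, qval e (T *ᵥ v) = α * qval d v) : Tᵀ * diagonal e * T = α • diagonal d := by
  have hb (u v : ι → R) : bval e (T *ᵥ u) (T *ᵥ v) = α * bval d u v := by
    apply h2.mul_left_cancel
    have := h (u + v)
    rw [mulVec_add, qval_add, qval_add, h, h] at this
    linear_combination this
  ext i j
  have := hb (Pi.single i 1) (Pi.single j 1)
  rw [bval_single] at this
  simp only [mulVec_single_one, bval, Matrix.col_apply] at this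
  rw [Matrix.mul_apply, Matrix.smul_apply, smul_eq_mul, diagonal_apply]
  simp only [mul_diagonal, transpose_apply]
  refine (Finset.sum_congr rfl fun k _ => ?_).trans (this.trans ?_)
  · ring
  · by_cases hij : i = j
    · subst hij; simp
    · simp [hij, Ne.symm hij]

theorem formIso_iff_isometric (h2 : IsUnit (2 : R)) {m n : ℕ} {d : Fin m → R} {e : Fin n → R} :
    FormIso d e ↔ Isometric d e := by
  constructor
  · rintro ⟨M, N, h1, h2, h3⟩
    refine ⟨Matrix.toLin'OfInv h1 h2, fun v => ?_⟩
    have := qval_mulVec (α := 1) (T := M) (by rw [h3, one_smul]) v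
    rwa [one_mul] at this
  · rintro ⟨φ, hφ⟩
    refine ⟨LinearMap.toMatrix' φ.toLinearMap, LinearMap.toMatrix' φ.symm.toLinearMap, ?_, ?_, ?_⟩
    · rw [← LinearMap.toMatrix'_comp]; simp
    · rw [← LinearMap.toMatrix'_comp]; simp
    · have := gram_of_qval h2 (T := LinearMap.toMatrix' φ.toLinearMap) (d := d) (e := e) (α := 1)
        fun v => by
          rw [LinearMap.toMatrix'_mulVec, one_mul]
          exact hφ v
      rwa [one_smul] at this

theorem hypform_eq (k : ℕ) :
    (hypform k : Fin (k + k) → R) = hypPlanes R (Fin k) ∘ finSumFinEquiv.symm := by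
  ext i
  obtain ⟨x, rfl⟩ := finSumFinEquiv.surjective i
  rw [Function.comp_apply, Equiv.symm_apply_apply]
  rcases x with x | x
  · rw [finSumFinEquiv_apply_left, hypform, Fin.append_left]; rfl
  · rw [finSumFinEquiv_apply_right, hypform, Fin.append_right]; rfl

theorem hyp_iff_isHyperbolic (h2 : IsUnit (2 : R)) {m : ℕ} {d : Fin m → R} :
    Hyp d ↔ IsHyperbolic d := by
  refine exists_congr fun k => ?_
  rw [← formIso_iff_isometric h2, hypform_eq]
  have := FormIso.reindex (hypPlanes R (Fin k)) finSumFinEquiv.symm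
  exact ⟨fun h => h.trans this.symm, fun h => h.trans this⟩

theorem tensorQF_formIso {m n : ℕ} (d : Fin m → R) (e : Fin n → R) :
    FormIso (tensorQF d e) (formMul d e) :=
  FormIso.reindex (formMul d e) finProdFinEquiv.symm

theorem FormIso.card_eq [Nontrivial R] {d : ι → R} {e : κ → R} (h : FormIso d e) :
    Fintype.card ι = Fintype.card κ := by
  obtain ⟨M, N, h1, h2, -⟩ := h
  rw [← Module.finrank_fintype_fun_eq_card R, ← Module.finrank_fintype_fun_eq_card R]
  exact (Matrix.toLin'OfInv h1 h2).finrank_eq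

end QuadraticValues

end QF

namespace QF

open Matrix

section WittDecomposition

variable {K : Type*} [Field K]

theorem FormIso.ne_zero {ι κ : Type} [Fintype ι] [Fintype κ] [DecidableEq ι] [DecidableEq κ]
    {d : ι → K} {e : κ → K} (h : FormIso d e) (hd : ∀ i, d i ≠ 0) (j : κ) : e j ≠ 0 := by
  obtain ⟨M, N, h1, h2, h3⟩ := h.symm
  intro hj
  have hD : diagonal d * diagonal (fun i => (d i)⁻¹) = 1 := by
    rw [diagonal_mul_diagonal, ← diagonal_one]
    congr 1; ext i; exact mul_inv_cancel₀ (hd i)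
  have key : diagonal e * (N * diagonal (fun i => (d i)⁻¹) * Nᵀ) = 1 := by
    calc _ = Mᵀ * (diagonal d * (M * N) * diagonal (fun i => (d i)⁻¹)) * Nᵀ := by
          rw [← h3]; simp only [Matrix.mul_assoc]
      _ = (N * M)ᵀ := by rw [h2, Matrix.mul_one, hD, Matrix.mul_one, transpose_mul]
      _ = 1 := by rw [h1, transpose_one]
  have := congrFun (congrFun key j) j
  rw [diagonal_mul, hj, zero_mul, one_apply_eq] at this
  exact zero_ne_one this

/-- The vectors of a basis orthogonal for `d` diagonalize `d`. -/
theorem formIso_of_orthogonal_basis {n : ℕ} {κ : Type} [Fintype κ] [DecidableEq κ]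
    {d : Fin n → K} (b : Module.Basis κ K (Fin n → K))
    (hb : ∀ i j, i ≠ j → bval d (b i) (b j) = 0) : FormIso d (fun i => qval d (b i)) := by
  refine FormIso.symm ⟨(Pi.basisFun K (Fin n)).toMatrix b, b.toMatrix (Pi.basisFun K (Fin n)),
    ?_, ?_, ?_⟩
  · rw [Module.Basis.toMatrix_mul_toMatrix_flip]
  · rw [Module.Basis.toMatrix_mul_toMatrix_flip]
  · ext i j
    have : (((Pi.basisFun K (Fin n)).toMatrix b)ᵀ * diagonal d *
        (Pi.basisFun K (Fin n)).toMatrix b) i j = bval d (b i) (b j) := by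
      rw [Matrix.mul_apply]
      refine Finset.sum_congr rfl fun k _ => ?_
      rw [mul_diagonal, transpose_apply, Module.Basis.toMatrix_apply, Module.Basis.toMatrix_apply,
        Pi.basisFun_repr, Pi.basisFun_repr]
      ring
    rw [this]
    by_cases hij : i = j
    · subst hij; rw [diagonal_apply_eq, bval_self]
    · rw [diagonal_apply_ne _ hij, hb i j hij]

/-- The bilinear form `bval d` as a bilinear map. -/
def bilin {ι : Type} [Fintype ι] (d : ι → K) : LinearMap.BilinForm K (ι → K) :=
  LinearMap.mk₂ K (bval d)
    (fun u v w => by rw [bval_comm, bval_add_right, bval_comm d w, bval_comm d w])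
    (fun c u v => by rw [bval_comm, bval_smul_right, bval_comm d v, smul_eq_mul])
    (bval_add_right d) (fun c u v => by rw [bval_smul_right, smul_eq_mul])

theorem exists_hyperbolic_pair (h2 : (2 : K) ≠ 0) {n : ℕ} {d : Fin n → K} (hd : ∀ i, d i ≠ 0)
    {v : Fin n → K} (hv : v ≠ 0) (hq : qval d v = 0) :
    ∃ x y, qval d x = 1 ∧ qval d y = -1 ∧ bval d x y = 0 := by
  obtain ⟨i, hi⟩ := Function.ne_iff.mp hv
  have hB : bval d v (Pi.single i 1) ≠ 0 := by
    rw [bval_single]; exact mul_ne_zero (hd i) hi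
  set B := bval d v (Pi.single i 1) with hBdef
  set Q := qval d (Pi.single i (1 : K)) with hQdef
  set f : Fin n → K := (2 * B)⁻¹ • (Pi.single i 1 + (-(Q / (2 * B))) • v) with hf
  have hvf : bval d v f = 2⁻¹ := by
    rw [hf, bval_smul_right, bval_add_right, bval_smul_right, bval_self, hq, ← hBdef]
    field_simp; simp
  have hqf : qval d f = 0 := by
    rw [hf, qval_smul, qval_add, qval_smul, hq, bval_smul_right, bval_comm, ← hBdef, ← hQdef]
    field_simp; ring
  have hneg : qval d (-f) = 0 := by
    rw [← neg_one_smul K f, qval_smul, hqf, mul_zero]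
  have hneg' (u) : bval d u (-f) = - bval d u f := by
    rw [← neg_one_smul K f, bval_smul_right]; ring
  refine ⟨v + f, v + -f, ?_, ?_, ?_⟩
  · rw [qval_add, hq, hqf, hvf]; field_simp; simp
  · rw [qval_add, hq, hneg, hneg', hvf]; field_simp; simp
  · rw [bval_add_right, hneg', bval_comm d _ v, bval_comm d _ f, bval_add_right, bval_add_right,
      bval_self, bval_self, hq, hqf, bval_comm d f v]; ring

theorem exists_split_plane (h2 : (2 : K) ≠ 0) {n : ℕ} {d : Fin n → K} (hd : ∀ i, d i ≠ 0)
    {v : Fin n → K} (hv : v ≠ 0) (hq : qval d v = 0) :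
    ∃ (m : ℕ) (r : Fin m → K), FormIso d (Sum.elim r (hypPlanes K (Fin 1))) := by
  obtain ⟨x, y, hx, hy, hxy⟩ := exists_hyperbolic_pair h2 hd hv hq
  let W : Submodule K (Fin n → K) := LinearMap.ker (bilin d x) ⊓ LinearMap.ker (bilin d y)
  have hW {z} (hz : z ∈ W) : bval d x z = 0 ∧ bval d y z = 0 := hz
  let _ : Invertible (2 : K) := invertibleOfNonzero h2
  obtain ⟨b, hb⟩ := LinearMap.BilinForm.exists_orthogonal_basis
    (B := (bilin d).restrict W) ⟨fun u w => bval_comm d _ _⟩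
  have hb' (i j) (hij : i ≠ j) : bval d (b i) (b j) = 0 := hb hij
  clear hb
  generalize Module.finrank K W = m at b
  have hbx (i) := (hW (b i).2).1
  have hby (i) := (hW (b i).2).2
  let c : Fin m ⊕ (Fin 1 ⊕ Fin 1) → (Fin n → K) :=
    Sum.elim (fun i => b i) (Sum.elim (fun _ => x) fun _ => y)
  have hortho (i j) (hij : i ≠ j) : bval d (c i) (c j) = 0 := by
    have hs (i j : Fin 1) : i = j := Subsingleton.elim i j
    rcases i with i | i | i <;> rcases j with j | j | j
    · exact hb' i j (fun h => hij (congrArg _ h))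
    · exact (bval_comm d _ _).trans (hbx i)
    · exact (bval_comm d _ _).trans (hby i)
    · exact hbx j
    · exact absurd (by rw [hs i j]) hij
    · exact hxy
    · exact hby j
    · exact (bval_comm d _ _).trans hxy
    · exact absurd (by rw [hs i j]) hij
  have hli : LinearIndependent K c := by
    rw [Fintype.linearIndependent_iff]
    intro g hg
    simp only [Fintype.sum_sum_type, Finset.univ_unique, Finset.sum_singleton, c, Sum.elim_inl,
      Sum.elim_inr] at hg
    set s := g (Sum.inr (Sum.inl default)) with hs
    set t := g (Sum.inr (Sum.inr default)) with ht
    let w : W := ∑ i, g (Sum.inl i) • b i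
    have hw : (w : Fin n → K) = ∑ i, g (Sum.inl i) • (b i : Fin n → K) := by
      simp [w]
    rw [← hw] at hg
    have hs0 : s = 0 := by
      have := congrArg (bval d x) hg
      rw [bval_add_right, bval_add_right, bval_smul_right, bval_smul_right, bval_self, hx, hxy,
        (hW w.2).1] at this
      simpa [bval] using this
    have ht0 : t = 0 := by
      have := congrArg (bval d y) hg
      rw [bval_add_right, bval_add_right, bval_smul_right, bval_smul_right, bval_self, hy,
        bval_comm d y x, hxy, (hW w.2).2] at this
      simpa [bval] using this
    rw [hs0, ht0, zero_smul, zero_smul, add_zero, add_zero] at hg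
    have hw0 : ∑ i, g (Sum.inl i) • b i = 0 := Subtype.ext hg
    rintro (i | i | i)
    · exact Fintype.linearIndependent_iff.mp b.linearIndependent _ hw0 i
    · rw [Subsingleton.elim i default]; exact hs0
    · rw [Subsingleton.elim i default]; exact ht0
  have hspan : ⊤ ≤ Submodule.span K (Set.range c) := by
    intro z _
    have hz : z + (-bval d x z) • x + bval d y z • y ∈ W := by
      constructor
      · change bval d x _ = 0
        rw [bval_add_right, bval_add_right, bval_smul_right, bval_smul_right, bval_self, hx, hxy]
        ring
      · change bval d y _ = 0
        rw [bval_add_right, bval_add_right, bval_smul_right, bval_smul_right, bval_self, hy,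
          bval_comm d y x, hxy]
        ring
    have hmem (i) : c i ∈ Submodule.span K (Set.range c) := Submodule.subset_span ⟨i, rfl⟩
    have hw := congrArg (W.subtype) (b.sum_repr ⟨_, hz⟩)
    rw [map_sum] at hw
    have hw' : z + (-bval d x z) • x + bval d y z • y ∈ Submodule.span K (Set.range c) := by
      rw [← show _ = z + (-bval d x z) • x + bval d y z • y from hw]
      exact Submodule.sum_mem _ fun i _ => Submodule.smul_mem _ _ (hmem (Sum.inl i))
    have := Submodule.sub_mem _ (Submodule.sub_mem _ hw'
      (Submodule.smul_mem _ (bval d y z) (hmem (Sum.inr (Sum.inr 0)))))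
      (Submodule.smul_mem _ (-bval d x z) (hmem (Sum.inr (Sum.inl 0))))
    rwa [show c (Sum.inr (Sum.inr 0)) = y from rfl, show c (Sum.inr (Sum.inl 0)) = x from rfl,
      add_sub_cancel_right, add_sub_cancel_right] at this
  let cb := Module.Basis.mk hli hspan
  refine ⟨m, fun i => qval d (b i), ?_⟩
  convert formIso_of_orthogonal_basis (d := d) cb fun i j hij => ?_ using 1
  · ext i
    rcases i with i | i | i <;> simp [cb, c, hypPlanes, hx, hy]
  · simpa [cb] using hortho i j hij

theorem exists_witt_decomposition (h2 : (2 : K) ≠ 0) {n : ℕ} (d : Fin n → K)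
    (hd : ∀ i, d i ≠ 0) : ∃ (m k : ℕ) (r : Fin m → K), (∀ v, qval r v = 0 → v = 0) ∧
      FormIso d (Sum.elim r (hypPlanes K (Fin k))) := by
  induction n using Nat.strong_induction_on with
  | _ n ih =>
    by_cases hani : ∀ v, qval d v = 0 → v = 0
    · refine ⟨n, 0, d, hani, ?_⟩
      exact FormIso.reindex (Sum.elim d (hypPlanes K (Fin 0))) (Equiv.sumEmpty _ _).symm
    · push Not at hani
      obtain ⟨v, hq, hv⟩ := hani
      obtain ⟨m, r, hr⟩ := exists_split_plane h2 hd hv hq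
      have hcard := hr.card_eq
      simp only [Fintype.card_sum, Fintype.card_fin] at hcard
      obtain ⟨m', k, r', hr', hiso⟩ := ih m (by omega) r
        fun i => hr.ne_zero hd (Sum.inl i)
      refine ⟨m', k + 1, r', hr', ?_⟩
      refine hr.trans ((hiso.sum (FormIso.refl _)).trans ?_)
      convert FormIso.reindex (Sum.elim r' (hypPlanes K (Fin (k + 1))))
        ((Equiv.sumAssoc (Fin m') (Fin k ⊕ Fin k) (Fin 1 ⊕ Fin 1)).trans
          ((Equiv.refl _).sumCongr ((Equiv.sumSumSumComm (Fin k) (Fin k) (Fin 1) (Fin 1)).trans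
            (finSumFinEquiv.sumCongr finSumFinEquiv)))) using 1
      ext x
      rcases x with (x | x | x) | x | x <;> rfl

theorem exists_witt_decomposition_of_fintype (h2 : (2 : K) ≠ 0) {ι : Type} [Fintype ι]
    [DecidableEq ι] (d : ι → K) (hd : ∀ i, d i ≠ 0) : ∃ (m k : ℕ) (r : Fin m → K),
      (∀ v, qval r v = 0 → v = 0) ∧ FormIso d (Sum.elim r (hypPlanes K (Fin k))) := by
  obtain ⟨m, k, r, hr, h⟩ := exists_witt_decomposition h2 (d ∘ (Fintype.equivFin ι).symm)
    fun i => hd _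
  exact ⟨m, k, r, hr, (FormIso.reindex d (Fintype.equivFin ι).symm).symm.trans h⟩

end WittDecomposition

end QF

namespace QF

section Isotropic

variable {E V V₁ V₂ : Type*} [Field E] [AddCommGroup V] [AddCommGroup V₁] [AddCommGroup V₂]
  [Module E V] [Module E V₁] [Module E V₂]

theorem finrank_map_add_finrank_inf_ker [FiniteDimensional E V] (f : V →ₗ[E] V₁)
    (P : Submodule E V) : Module.finrank E (P.map f) +
      Module.finrank E (P ⊓ LinearMap.ker f : Submodule E V) = Module.finrank E P := by
  rw [← (f.domRestrict P).finrank_range_add_finrank_ker, LinearMap.range_domRestrict,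
    LinearMap.ker_domRestrict]
  congr 1
  rw [← Submodule.finrank_map_subtype_eq, Submodule.map_comap_subtype]

/-- If an isotropic subspace `U` of an orthogonal sum `V₁ ⊥ V₂` is large and `V₂` is metabolic
with Lagrangian `M`, then the vectors of `U` with second component in `M` project to a large
subspace of `V₁`. -/
theorem finrank_le_two_mul_finrank_map_fst [FiniteDimensional E V₁] [FiniteDimensional E V₂]
    (B₁ : LinearMap.BilinForm E V₁) (B₂ : LinearMap.BilinForm E V₂) (hnd : B₂.Nondegenerate)
    (U : Submodule E (V₁ × V₂)) (hU : ∀ x ∈ U, ∀ y ∈ U, B₁ x.1 y.1 + B₂ x.2 y.2 = 0)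
    (hdim : Module.finrank E V₁ + Module.finrank E V₂ ≤ 2 * Module.finrank E U)
    (M : Submodule E V₂) (hM : ∀ x ∈ M, ∀ y ∈ M, B₂ x y = 0)
    (hMdim : Module.finrank E V₂ ≤ 2 * Module.finrank E M) :
    Module.finrank E V₁ ≤ 2 * Module.finrank E
      ((U ⊓ M.comap (LinearMap.snd E V₁ V₂)).map (LinearMap.fst E V₁ V₂)) := by
  set P := U ⊓ M.comap (LinearMap.snd E V₁ V₂) with hP
  let M₀ : Submodule E V₂ := M ⊓ U.comap (LinearMap.inr E V₁ V₂)
  have e1 := finrank_map_add_finrank_inf_ker (LinearMap.fst E V₁ V₂) P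
  have e2 := finrank_map_add_finrank_inf_ker (LinearMap.snd E V₁ V₂) P
  have e3 := finrank_map_add_finrank_inf_ker (LinearMap.snd E V₁ V₂) U
  have e4 := Submodule.finrank_sup_add_finrank_inf_eq (U.map (LinearMap.snd E V₁ V₂)) M
  have e5 := LinearMap.BilinForm.finrank_orthogonal hnd M₀
  have i1 : Module.finrank E (P ⊓ LinearMap.ker (LinearMap.fst E V₁ V₂) : Submodule E (V₁ × V₂)) ≤
      Module.finrank E M₀ := by
    refine le_trans (Submodule.finrank_mono (t := M₀.map (LinearMap.inr E V₁ V₂)) ?_)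
      (Submodule.finrank_map_le _ _)
    rintro ⟨u, w⟩ ⟨⟨hu, hw⟩, h⟩
    have h : u = 0 := h
    subst h
    exact ⟨w, ⟨hw, hu⟩, rfl⟩
  have i2 : Module.finrank E (U ⊓ LinearMap.ker (LinearMap.snd E V₁ V₂) : Submodule E (V₁ × V₂)) ≤
      Module.finrank E (P ⊓ LinearMap.ker (LinearMap.snd E V₁ V₂) : Submodule E (V₁ × V₂)) := by
    refine Submodule.finrank_mono ?_
    rintro ⟨u, w⟩ ⟨hu, h⟩
    have h : w = 0 := h
    subst h
    exact ⟨⟨hu, M.zero_mem⟩, rfl⟩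
  have i3 : Module.finrank E (U.map (LinearMap.snd E V₁ V₂) ⊓ M : Submodule E V₂) ≤
      Module.finrank E (P.map (LinearMap.snd E V₁ V₂)) := by
    refine Submodule.finrank_mono ?_
    rintro w ⟨⟨x, hx, rfl⟩, hw⟩
    exact ⟨x, ⟨hx, hw⟩, rfl⟩
  have i4 : Module.finrank E (U.map (LinearMap.snd E V₁ V₂) ⊔ M : Submodule E V₂) ≤
      Module.finrank E (B₂.orthogonal M₀) := by
    refine Submodule.finrank_mono (sup_le ?_ ?_)
    · rintro _ ⟨x, hx, rfl⟩ y ⟨-, hy⟩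
      have := hU (0, y) hy x hx
      simpa using this
    · rintro x hx y ⟨hy, -⟩
      exact hM y hy x hx
  have i5 := Submodule.finrank_le M₀
  omega

end Isotropic

end QF

namespace QF

open Matrix

section Factors

variable {R S : Type*} [CommRing R] [CommRing S]
variable {ι κ : Type} [Fintype ι] [Fintype κ] [DecidableEq ι] [DecidableEq κ]

/-- `α` is a multiplier of an endomorphism of the form `d` (for units `α`: a similarity
factor). -/
def HasFactor (d : ι → R) (α : R) : Prop :=
  ∃ T : Matrix ι ι R, Tᵀ * diagonal d * T = α • diagonal d

theorem HasFactor.of_iso {d : ι → R} {e : κ → R} {α : R} (h : FormIso d e)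
    (he : HasFactor e α) : HasFactor d α := by
  obtain ⟨M, N, h1, h2, h3⟩ := h
  obtain ⟨T, hT⟩ := he
  have hN : Nᵀ * Mᵀ = 1 := by rw [← transpose_mul, h2, transpose_one]
  refine ⟨N * T * M, ?_⟩
  calc (N * T * M)ᵀ * diagonal d * (N * T * M)
      = Mᵀ * (Tᵀ * ((Nᵀ * Mᵀ) * diagonal e * (M * N)) * T) * M := by
        rw [← h3]; simp only [transpose_mul, Matrix.mul_assoc]
    _ = α • diagonal d := by
        rw [hN, h2, Matrix.one_mul, Matrix.mul_one, hT, Matrix.mul_smul, Matrix.smul_mul, h3]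

theorem HasFactor.sum {d : ι → R} {e : κ → R} {α : R} (hd : HasFactor d α)
    (he : HasFactor e α) : HasFactor (Sum.elim d e) α := by
  obtain ⟨T, hT⟩ := hd
  obtain ⟨S, hS⟩ := he
  refine ⟨fromBlocks T 0 0 S, ?_⟩
  rw [← fromBlocks_diagonal, fromBlocks_transpose, fromBlocks_multiply, fromBlocks_multiply,
    fromBlocks_smul]
  simp [hT, hS]

theorem HasFactor.mul {d : ι → R} {α β : R} (hα : HasFactor d α) (hβ : HasFactor d β) :
    HasFactor d (α * β) := by
  obtain ⟨T, hT⟩ := hα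
  obtain ⟨S, hS⟩ := hβ
  refine ⟨T * S, ?_⟩
  calc (T * S)ᵀ * diagonal d * (T * S) = Sᵀ * (Tᵀ * diagonal d * T) * S := by
        simp only [transpose_mul, Matrix.mul_assoc]
    _ = _ := by rw [hT, Matrix.mul_smul, Matrix.smul_mul, hS, smul_smul]

theorem hasFactor_sq (d : ι → R) (c : R) : HasFactor d (c ^ 2) :=
  ⟨c • 1, by rw [transpose_smul, transpose_one, Matrix.smul_mul, Matrix.one_mul,
    Matrix.mul_smul, Matrix.mul_one, smul_smul, pow_two]⟩

theorem HasFactor.of_sq_mul {K : Type*} [Field K] {d : ι → K} {c α : K} (hc : c ≠ 0)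
    (h : HasFactor d (c ^ 2 * α)) : HasFactor d α := by
  convert (hasFactor_sq d c⁻¹).mul h using 1
  field_simp

theorem HasFactor.map (f : R →+* S) {d : ι → R} {α : R} (h : HasFactor d α) :
    HasFactor (fun i => f (d i)) (f α) := by
  obtain ⟨T, hT⟩ := h
  refine ⟨T.map f, ?_⟩
  have := congrArg (fun X => X.map f) hT
  have hs : (α • diagonal d).map f = f α • diagonal fun i => f (d i) := by
    ext i j; by_cases hij : i = j <;> simp [hij]
  rw [hs] at this
  simpa [Matrix.map_mul, transpose_map, diagonal_map] using this

theorem hasFactor_hypPlanes {h : R} (h2 : 2 * h = 1) (α : R) : HasFactor (hypPlanes R κ) α := by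
  refine ⟨fromBlocks (diagonal fun _ => h * (α + 1)) (diagonal fun _ => h * (1 - α))
    (diagonal fun _ => h * (1 - α)) (diagonal fun _ => h * (α + 1)), ?_⟩
  rw [hypPlanes, ← fromBlocks_diagonal, fromBlocks_transpose, fromBlocks_multiply,
    fromBlocks_multiply, fromBlocks_smul]
  simp only [diagonal_transpose, diagonal_mul_diagonal, diagonal_add, Matrix.mul_zero,
    add_zero, zero_add, smul_zero]
  congr 1
  · ext i j; by_cases hij : i = j
    · simp only [diagonal_apply, hij, Matrix.smul_apply, smul_eq_mul, if_true]
      linear_combination (α * (1 + 2 * h)) * h2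
    · simp [hij]
  · rw [← diagonal_zero]; congr 1; ext i
    ring
  · rw [← diagonal_zero]; congr 1; ext i
    ring
  · ext i j; by_cases hij : i = j
    · simp only [diagonal_apply, hij, Matrix.smul_apply, smul_eq_mul, if_true]
      linear_combination (-α * (1 + 2 * h)) * h2
    · simp [hij]

end Factors

section PfisterFactors

variable {K : Type*} [Field K] {ι : Type} [Fintype ι] [DecidableEq ι]

/-- If `α` and `β` are factors of `d`, then `α + aβ` is a factor of `⟨1,a⟩ ⊗ d`. -/
theorem HasFactor.double {d : ι → K} (hd : ∀ i, d i ≠ 0) {α β : K} (hα : HasFactor d α)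
    (hβ : HasFactor d β) (a : K) :
    HasFactor (Sum.elim d (fun i => a * d i)) (α + a * β) := by
  have had : diagonal (fun i => a * d i) = a • diagonal d := by
    ext i j; by_cases hij : i = j <;> simp [hij]
  suffices h : ∃ T S T' : Matrix ι ι K, Tᵀ * diagonal d * T = α • diagonal d ∧
      Sᵀ * diagonal d * S = β • diagonal d ∧ T'ᵀ * diagonal d * T' = α • diagonal d ∧
      Sᵀ * diagonal d * T' = Tᵀ * diagonal d * S by
    obtain ⟨T, S, T', hT, hS, hT', hST⟩ := h
    have hTS : T'ᵀ * diagonal d * S = Sᵀ * diagonal d * T := by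
      have := congrArg transpose hST
      simpa [transpose_mul, Matrix.mul_assoc] using this
    refine ⟨fromBlocks T (-a • S) S T', ?_⟩
    rw [← fromBlocks_diagonal, fromBlocks_transpose, fromBlocks_multiply, fromBlocks_multiply,
      fromBlocks_smul, had]
    simp only [Matrix.mul_zero, add_zero, zero_add, smul_zero, Matrix.mul_smul, transpose_smul,
      Matrix.smul_mul, hT, hS, hT', hST, hTS, smul_smul]
    congr 1
    · rw [add_smul]
    · rw [← add_smul]; simp
    · rw [← add_smul]; simp
    · rw [← add_smul]; congr 1; ring
  obtain ⟨T, hT⟩ := hα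
  obtain ⟨S, hS⟩ := hβ
  set D := diagonal d with hD
  set D' := diagonal (fun i => (d i)⁻¹) with hD'
  have hDD' : D * D' = 1 := by
    rw [hD, hD', diagonal_mul_diagonal, ← diagonal_one]
    congr 1; ext i; exact mul_inv_cancel₀ (hd i)
  have hD'D : D' * D = 1 := mul_eq_one_comm.mp hDD'
  have hD't : D'ᵀ = D' := diagonal_transpose _
  have hDt : Dᵀ = D := diagonal_transpose _
  by_cases hβ0 : β = 0
  · exact ⟨T, 0, T, hT, by simp [hβ0], hT, by simp⟩
  by_cases hα0 : α = 0
  · exact ⟨0, S, 0, by simp [hα0], hS, by simp [hα0], by simp⟩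
  have hTT : T * D' * Tᵀ = α • D' := by
    have h1 : (α⁻¹ • (D' * Tᵀ * D)) * T = 1 := by
      rw [Matrix.smul_mul, Matrix.mul_assoc, Matrix.mul_assoc, ← Matrix.mul_assoc Tᵀ, hT,
        Matrix.mul_smul, hD'D, smul_smul, inv_mul_cancel₀ hα0, one_smul]
    have h2 := mul_eq_one_comm.mp h1
    rw [Matrix.mul_smul] at h2
    calc T * D' * Tᵀ = T * (D' * Tᵀ * D) * D' := by
          simp only [Matrix.mul_assoc, hDD', Matrix.mul_one]
      _ = α • ((α⁻¹ • (T * (D' * Tᵀ * D))) * D') := by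
          rw [Matrix.smul_mul, smul_smul, mul_inv_cancel₀ hα0, one_smul]
      _ = _ := by rw [h2, Matrix.one_mul]
  refine ⟨T, S, β⁻¹ • (S * D' * Tᵀ * D * S), hT, hS, ?_, ?_⟩
  · simp only [transpose_smul, transpose_mul, transpose_transpose, hDt, hD't, Matrix.smul_mul,
      Matrix.mul_smul, smul_smul]
    calc _ = (β⁻¹ * β⁻¹) • (Sᵀ * D * T * D' * (Sᵀ * D * S) * D' * Tᵀ * D * S) := by
          simp only [Matrix.mul_assoc]
      _ = β⁻¹ • (Sᵀ * D * T * D' * (D * D') * Tᵀ * D * S) := by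
          rw [hS]
          simp only [Matrix.smul_mul, Matrix.mul_smul, smul_smul, Matrix.mul_assoc]
          congr 1; field_simp
      _ = β⁻¹ • (Sᵀ * D * (T * D' * Tᵀ) * D * S) := by
          rw [hDD', Matrix.mul_one]; simp only [Matrix.mul_assoc]
      _ = (β⁻¹ * α) • (Sᵀ * ((D * D') * D) * S) := by
          rw [hTT]
          simp only [Matrix.smul_mul, Matrix.mul_smul, smul_smul, Matrix.mul_assoc]
      _ = α • D := by
          rw [hDD', Matrix.one_mul, hS, smul_smul]; congr 1; field_simp
  · calc Sᵀ * D * (β⁻¹ • (S * D' * Tᵀ * D * S))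
        = β⁻¹ • ((Sᵀ * D * S) * D' * Tᵀ * D * S) := by
          simp only [Matrix.mul_smul, Matrix.mul_assoc]
      _ = (D * D') * Tᵀ * D * S := by
          rw [hS]; simp only [Matrix.smul_mul, smul_smul, inv_mul_cancel₀ hβ0, one_smul]
      _ = Tᵀ * D * S := by rw [hDD', Matrix.one_mul]

/-- The coefficients of the Pfister form with slots `a`, indexed by `Fin n → Fin 2`. -/
def pfisterCoeff {R : Type*} [CommRing R] {n : ℕ} (a : Fin n → R) (j : Fin n → Fin 2) : R :=
  ∏ i, if j i = 0 then 1 else a i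

theorem pfisterCoeff_cons_zero {R : Type*} [CommRing R] {n : ℕ} (a : Fin (n + 1) → R)
    (j : Fin n → Fin 2) :
    pfisterCoeff a (Fin.cons 0 j) = pfisterCoeff (fun i => a i.succ) j := by
  simp [pfisterCoeff, Fin.prod_univ_succ]

theorem pfisterCoeff_cons_one {R : Type*} [CommRing R] {n : ℕ} (a : Fin (n + 1) → R)
    (j : Fin n → Fin 2) :
    pfisterCoeff a (Fin.cons 1 j) = a 0 * pfisterCoeff (fun i => a i.succ) j := by
  simp [pfisterCoeff, Fin.prod_univ_succ]

theorem pfisterCoeff_ne_zero {n : ℕ} {a : Fin n → K} (ha : ∀ i, a i ≠ 0) (j : Fin n → Fin 2) :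
    pfisterCoeff a j ≠ 0 :=
  Finset.prod_ne_zero_iff.mpr fun i _ => by split_ifs; exacts [one_ne_zero, ha i]

/-- Binary strings of length `n + 1`, split by their first letter. -/
def consSumEquiv (n : ℕ) : (Fin (n + 1) → Fin 2) ≃ (Fin n → Fin 2) ⊕ (Fin n → Fin 2) where
  toFun j := if j 0 = 0 then Sum.inl (Fin.tail j) else Sum.inr (Fin.tail j)
  invFun := Sum.elim (fun j => Fin.cons 0 j) (fun j => Fin.cons 1 j)
  left_inv j := by
    by_cases h : j 0 = 0
    · simp only [h, if_true, Sum.elim_inl]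
      conv_rhs => rw [← Fin.cons_self_tail j, h]
    · have h1 : j 0 = 1 := Fin.eq_one_of_ne_zero _ h
      simp only [h, if_false, Sum.elim_inr]
      conv_rhs => rw [← Fin.cons_self_tail j, h1]
  right_inv x := by rcases x with x | x <;> simp

/-- If all `α j` are factors of `q`, then the value of the Pfister form with the squares of the
arguments replaced by the `α j` is a factor of its product with `q`. -/
theorem HasFactor.pfister {q : ι → K} (hq : ∀ i, q i ≠ 0) {n : ℕ} (a : Fin n → K)
    (ha : ∀ i, a i ≠ 0) (α : (Fin n → Fin 2) → K) (hα : ∀ j, HasFactor q (α j)) :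
    HasFactor (formMul (pfisterCoeff a) q) (∑ j, pfisterCoeff a j * α j) := by
  induction n with
  | zero =>
    refine HasFactor.of_iso ?_ (e := q) ?_
    · convert FormIso.reindex q (Equiv.uniqueProd ι (Fin 0 → Fin 2)) using 1
      ext x
      simp [formMul, pfisterCoeff]
    · convert hα default using 1
      simp only [pfisterCoeff, Finset.univ_unique, Finset.prod_of_isEmpty, one_mul,
        Finset.sum_singleton]
      exact congrArg α (Subsingleton.elim _ _)
  | succ n ih =>
    set a' : Fin n → K := fun i => a i.succ
    have h0 := ih a' (fun i => ha _) (fun j => α ((consSumEquiv n).symm (Sum.inl j)))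
      fun j => hα _
    have h1 := ih a' (fun i => ha _) (fun j => α ((consSumEquiv n).symm (Sum.inr j)))
      fun j => hα _
    have hne (x : (Fin n → Fin 2) × ι) : formMul (pfisterCoeff a') q x ≠ 0 :=
      mul_ne_zero (pfisterCoeff_ne_zero (fun i => ha i.succ) x.1) (hq x.2)
    have h := HasFactor.double hne h0 h1 (a 0)
    refine HasFactor.of_iso ?_ (e := Sum.elim (formMul (pfisterCoeff a') q)
      (fun x => a 0 * formMul (pfisterCoeff a') q x)) ?_
    · refine FormIso.symm ?_
      convert FormIso.reindex (formMul (pfisterCoeff a) q)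
        ((Equiv.sumProdDistrib _ _ ι).symm.trans
          ((consSumEquiv n).symm.prodCongr (Equiv.refl ι))) using 1
      ext x
      rcases x with x | x
      · simp [formMul, consSumEquiv, pfisterCoeff_cons_zero, a']
      · simp [formMul, consSumEquiv, pfisterCoeff_cons_one, a', mul_assoc]
    · convert h using 1
      rw [← (consSumEquiv n).symm.sum_comp, Fintype.sum_sum_type, Finset.mul_sum]
      congr 1
      · refine Finset.sum_congr rfl fun j _ => ?_
        simp [consSumEquiv, pfisterCoeff_cons_zero, a']
      · refine Finset.sum_congr rfl fun j _ => ?_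
        simp only [consSumEquiv, Equiv.coe_fn_symm_mk, Sum.elim_inr, pfisterCoeff_cons_one, a']
        ring

end PfisterFactors

end QF

namespace QF

open Matrix

section Isotropic

variable {E : Type*} [Field E] {ι κ : Type} [Fintype ι] [Fintype κ]

theorem bilin_nondegenerate {d : ι → E} (hd : ∀ i, d i ≠ 0) : (bilin d).Nondegenerate := by
  classical
  have h (u : ι → E) (hu : ∀ v, bval d u v = 0) : u = 0 := by
    ext i
    have := hu (Pi.single i 1)
    rw [bval_single] at this
    exact (mul_eq_zero.mp this).resolve_left (hd i)
  exact ⟨fun u hu => h u hu, fun u hu => h u fun v => (bval_comm d u v).trans (hu v)⟩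

theorem bval_sum_elim {R : Type*} [CommRing R] (d : ι → R) (e : κ → R) (x y : ι ⊕ κ → R) :
    bval (Sum.elim d e) x y = bval d (x ∘ Sum.inl) (y ∘ Sum.inl) +
      bval e (x ∘ Sum.inr) (y ∘ Sum.inr) := by
  simp [bval, Fintype.sum_sum_type]

/-- Let `d` be an orthogonal sum of `r` and hyperbolic planes and let `U` be a totally isotropic
subspace of `d ⊥ g d` of half the dimension. Then the vectors of `U` whose hyperbolic components
lie on the diagonal have a projection to `r ⊥ g r` of at least half the dimension. -/
theorem exists_large_projection {m k : ℕ} (r : Fin m → E) (g : E) (hg : g ≠ 0)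
    {d : Fin m ⊕ (Fin k ⊕ Fin k) → E} (hd : d = Sum.elim r (hypPlanes E (Fin k)))
    (U : Submodule E ((Fin m ⊕ (Fin k ⊕ Fin k)) ⊕ (Fin m ⊕ (Fin k ⊕ Fin k)) → E))
    (hU : ∀ x ∈ U, ∀ y ∈ U, bval (Sum.elim d (g • d)) x y = 0)
    (hdim : m + (k + k) ≤ Module.finrank E U) :
    ∃ U' : Submodule E (Fin m ⊕ Fin m → E), m ≤ Module.finrank E U' ∧ ∀ x ∈ U', ∃ y ∈ U,
      (∀ i, y (Sum.inl (Sum.inl i)) = x (Sum.inl i)) ∧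
      (∀ i, y (Sum.inr (Sum.inl i)) = x (Sum.inr i)) ∧
      (∀ j, y (Sum.inl (Sum.inr (Sum.inl j))) = y (Sum.inl (Sum.inr (Sum.inr j)))) ∧
      ∀ j, y (Sum.inr (Sum.inr (Sum.inl j))) = y (Sum.inr (Sum.inr (Sum.inr j))) := by
  let Φ : (((Fin m ⊕ (Fin k ⊕ Fin k)) ⊕ (Fin m ⊕ (Fin k ⊕ Fin k))) → E) →ₗ[E]
      (Fin m ⊕ Fin m → E) × ((Fin k ⊕ Fin k) ⊕ (Fin k ⊕ Fin k) → E) :=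
    (LinearMap.funLeft E E (Sum.map Sum.inl Sum.inl)).prod
      (LinearMap.funLeft E E (Sum.map Sum.inr Sum.inr))
  have hΦ₁ (x) : (Φ x).1 = x ∘ Sum.map Sum.inl Sum.inl := rfl
  have hΦ₂ (x) : (Φ x).2 = x ∘ Sum.map Sum.inr Sum.inr := rfl
  have hΦ : Function.Injective Φ := by
    intro x y hxy
    have h1 := congrFun (congrArg Prod.fst hxy)
    have h2 := congrFun (congrArg Prod.snd hxy)
    ext i
    rcases i with (i | i) | i | i
    exacts [h1 (Sum.inl i), h2 (Sum.inl i), h1 (Sum.inr i), h2 (Sum.inr i)]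
  let e : (Fin k ⊕ Fin k) ⊕ (Fin k ⊕ Fin k) → E :=
    Sum.elim (hypPlanes E (Fin k)) (g • hypPlanes E (Fin k))
  have hh (j) : hypPlanes E (Fin k) j ≠ 0 := by
    rcases j with j | j <;> simp [hypPlanes]
  have he (j) : e j ≠ 0 := by
    rcases j with j | j
    exacts [hh j, mul_ne_zero hg (hh j)]
  let c : (Fin k ⊕ Fin k) → Fin k := Sum.elim id id
  let M : Submodule E ((Fin k ⊕ Fin k) ⊕ (Fin k ⊕ Fin k) → E) :=
    LinearMap.range (LinearMap.funLeft E E (Sum.map c c))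
  have hM : Module.finrank E M = k + k := by
    rw [LinearMap.finrank_range_of_inj (LinearMap.funLeft_injective_of_surjective _ _ _ ?_)]
    · simp
    · rintro (j | j)
      exacts [⟨Sum.inl (Sum.inl j), rfl⟩, ⟨Sum.inr (Sum.inl j), rfl⟩]
  refine ⟨(U.map Φ ⊓ M.comap (LinearMap.snd E _ _)).map (LinearMap.fst E _ _), ?_, ?_⟩
  · have := finrank_le_two_mul_finrank_map_fst (bilin (Sum.elim r (g • r))) (bilin e)
      (bilin_nondegenerate he) (U.map Φ) ?_ ?_ M ?_ ?_
    · rw [Module.finrank_fintype_fun_eq_card, Fintype.card_sum, Fintype.card_fin, ← two_mul] at this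
      exact Nat.le_of_mul_le_mul_left this two_pos
    · rintro _ ⟨x, hx, rfl⟩ _ ⟨y, hy, rfl⟩
      rw [← hU x hx y hy, hd]
      simp only [bilin, LinearMap.mk₂_apply, bval, e, Fintype.sum_sum_type, Sum.elim_inl,
        Sum.elim_inr, Pi.smul_apply, hΦ₁, hΦ₂, Function.comp_apply, Sum.map_inl, Sum.map_inr]
      abel
    · rw [← (Submodule.equivMapOfInjective Φ hΦ U).finrank_eq, Module.finrank_fintype_fun_eq_card,
        Module.finrank_fintype_fun_eq_card]
      simp only [Fintype.card_sum, Fintype.card_fin]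
      omega
    · rintro _ ⟨x, rfl⟩ _ ⟨y, rfl⟩
      simp [bilin, bval, e, Fintype.sum_sum_type, c, hypPlanes, LinearMap.funLeft_apply]
    · rw [hM, Module.finrank_fintype_fun_eq_card]
      simp only [Fintype.card_sum, Fintype.card_fin]
      omega
  · rintro _ ⟨_, ⟨⟨y, hy, rfl⟩, ⟨z, hz⟩⟩, rfl⟩
    refine ⟨y, hy, fun i => rfl, fun i => rfl, fun j => ?_, fun j => ?_⟩
    · exact (congrFun hz (Sum.inl (Sum.inl j))).symm.trans (congrFun hz (Sum.inl (Sum.inr j)))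
    · exact (congrFun hz (Sum.inr (Sum.inl j))).symm.trans (congrFun hz (Sum.inr (Sum.inr j)))

end Isotropic

end QF

namespace QF

open Matrix Polynomial

section Residue

variable {K E : Type*} [Field K] [Field E] [Algebra K[X] E] [IsFractionRing K[X] E]

theorem X_pow_dvd_of_qval_eq {m : ℕ} {r : Fin m → K} (hr : ∀ v, qval r v = 0 → v = 0)
    {f₁ : K[X]} (hf₁ : f₁.eval 0 ≠ 0) (N : ℕ) {u w : Fin m → K[X]}
    (h : qval (fun i => C (r i)) u = X * f₁ * qval (fun i => C (r i)) w) (i : Fin m) :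
    X ^ N ∣ u i ∧ X ^ N ∣ w i := by
  have heval (v : Fin m → K[X]) (hv : (qval (fun i => C (r i)) v).eval 0 = 0) (i) : X ∣ v i := by
    rw [X_dvd_iff, coeff_zero_eq_eval_zero]
    refine congrFun (hr (fun i => (v i).eval 0) ?_) i
    simpa [qval, eval_finsetSum] using hv
  have hX (v : Fin m → K[X]) : qval (fun i => C (r i)) (fun i => X * v i) =
      X ^ 2 * qval (fun i => C (r i)) v := qval_smul _ X v
  induction N generalizing u w with
  | zero => simp
  | succ N ih =>
    choose u' hu' using heval u (by rw [h]; simp)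
    obtain rfl : u = fun i => X * u' i := funext hu'
    rw [hX] at h
    have h' : X * qval (fun i => C (r i)) u' = f₁ * qval (fun i => C (r i)) w :=
      mul_left_cancel₀ X_ne_zero (by linear_combination h)
    choose w' hw' using heval w (by
      have := congrArg (eval 0) h'
      rw [eval_mul, eval_mul, eval_X, zero_mul] at this
      exact (mul_eq_zero.mp this.symm).resolve_left hf₁)
    obtain rfl : w = fun i => X * w' i := funext hw'
    rw [hX] at h'
    have h'' : qval (fun i => C (r i)) u' = X * f₁ * qval (fun i => C (r i)) w' :=
      mul_left_cancel₀ X_ne_zero (by linear_combination h')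
    obtain ⟨h1, h2⟩ := ih h''
    rw [pow_succ']
    exact ⟨mul_dvd_mul_left _ h1, mul_dvd_mul_left _ h2⟩

/-- Over `K(X)`, an anisotropic form `r` over `K` and its multiple by an odd-order element at `0`
have no common value. -/
theorem eq_zero_of_qval_eq {m : ℕ} {r : Fin m → K} (hr : ∀ v, qval r v = 0 → v = 0)
    {f₁ : K[X]} (hf₁ : f₁.eval 0 ≠ 0) {u w : Fin m → E}
    (h : qval (fun i => algebraMap K[X] E (C (r i))) u =
      algebraMap K[X] E (X * f₁) * qval (fun i => algebraMap K[X] E (C (r i))) w) :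
    u = 0 ∧ w = 0 := by
  obtain ⟨b, hb⟩ := IsLocalization.exist_integer_multiples_of_finite (nonZeroDivisors K[X])
    (Sum.elim u w)
  choose z hz using hb
  have hb0 : algebraMap K[X] E b ≠ 0 :=
    IsFractionRing.to_map_ne_zero_of_mem_nonZeroDivisors b.2
  have hscale (v : Fin m → E) (v' : Fin m → K[X])
      (hv : ∀ i, algebraMap K[X] E (v' i) = (b : K[X]) • v i) :
      algebraMap K[X] E (qval (fun i => C (r i)) v') =
        algebraMap K[X] E b ^ 2 * qval (fun i => algebraMap K[X] E (C (r i))) v := by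
    rw [← qval_smul]
    simp only [qval, map_sum, map_mul, map_pow, hv, Pi.smul_apply, smul_eq_mul,
      Algebra.smul_def (R := K[X])]
  have key : qval (fun i => C (r i)) (fun i => z (Sum.inl i)) =
      X * f₁ * qval (fun i => C (r i)) (fun i => z (Sum.inr i)) := by
    apply IsFractionRing.injective K[X] E
    rw [map_mul, hscale u _ fun i => hz (Sum.inl i), hscale w _ fun i => hz (Sum.inr i), h]
    ring
  have hzero (p : K[X]) (hp : ∀ N, X ^ N ∣ p) : p = 0 := by
    by_contra h0
    have := natDegree_le_of_dvd (hp (p.natDegree + 1)) h0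
    rw [natDegree_X_pow] at this
    omega
  have hz0 (j) : z j = 0 := by
    rcases j with j | j
    · exact hzero _ fun N => (X_pow_dvd_of_qval_eq hr hf₁ N key j).1
    · exact hzero _ fun N => (X_pow_dvd_of_qval_eq hr hf₁ N key j).2
  have hv0 (j) : Sum.elim u w j = 0 := by
    have := hz j
    rw [hz0, map_zero, Algebra.smul_def] at this
    exact (mul_eq_zero.mp this.symm).resolve_left hb0
  exact ⟨funext fun i => hv0 (Sum.inl i), funext fun i => hv0 (Sum.inr i)⟩

/-- A form over `K` that has over `K(X)` a similarity factor of odd order at `0` is hyperbolic. -/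
theorem hyp_of_hasFactor (h2 : (2 : K) ≠ 0) {ι : Type} [Fintype ι] [DecidableEq ι] {d : ι → K}
    (hd : ∀ i, d i ≠ 0) {f₁ : K[X]} (hf₁ : f₁.eval 0 ≠ 0)
    (h : HasFactor (fun i => algebraMap K[X] E (C (d i)))
      (algebraMap K[X] E (X * f₁))) : Hyp d := by
  obtain ⟨m, k, r, hr, hiso⟩ := exists_witt_decomposition_of_fintype h2 d hd
  obtain rfl | hm := Nat.eq_zero_or_pos m
  · exact ⟨k, hiso.trans (FormIso.reindex (Sum.elim r (hypPlanes K (Fin k)))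
      (Equiv.emptySum _ _).symm).symm⟩
  exfalso
  set f : E := algebraMap K[X] E (X * f₁)
  have hf0 : f ≠ 0 := by
    rw [Ne, IsFractionRing.to_map_eq_zero_iff]
    exact mul_ne_zero X_ne_zero (by rintro rfl; simp at hf₁)
  have hiso' := hiso.map ((algebraMap K[X] E).comp C)
  obtain ⟨T, hT⟩ := HasFactor.of_iso hiso'.symm h
  set e := fun i => ((algebraMap K[X] E).comp C) (Sum.elim r (hypPlanes K (Fin k)) i)
  let Ψ : (Fin m ⊕ (Fin k ⊕ Fin k) → E) →ₗ[E]
      ((Fin m ⊕ (Fin k ⊕ Fin k)) ⊕ (Fin m ⊕ (Fin k ⊕ Fin k)) → E) :=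
    LinearMap.pi (Sum.elim (fun i => (LinearMap.proj i).comp T.mulVecLin) LinearMap.proj)
  have hΨl (u) : Ψ u ∘ Sum.inl = T *ᵥ u := rfl
  have hΨr (u) : Ψ u ∘ Sum.inr = u := rfl
  have hΨ : Function.Injective Ψ := fun u v huv => by rw [← hΨr u, huv, hΨr]
  have hiso₀ : ∀ u v, bval (Sum.elim e (-f • e)) (Ψ u) (Ψ v) = 0 := by
    intro u v
    rw [bval_sum_elim, hΨl, hΨl, hΨr, hΨr, bval_mulVec hT]
    simp only [bval, Finset.mul_sum, ← Finset.sum_add_distrib]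
    exact Finset.sum_eq_zero fun i _ => by simp only [Pi.smul_apply, smul_eq_mul]; ring
  have he : e = Sum.elim (fun i => algebraMap K[X] E (C (r i))) (hypPlanes E (Fin k)) := by
    ext i
    rcases i with i | i | i <;> simp [e, hypPlanes]
  obtain ⟨U', hU', hlift⟩ := exists_large_projection _ (-f) (neg_ne_zero.mpr hf0) he
    (LinearMap.range Ψ) (by rintro _ ⟨u, rfl⟩ _ ⟨v, rfl⟩; exact hiso₀ u v)
    (by rw [LinearMap.finrank_range_of_inj hΨ, Module.finrank_fintype_fun_eq_card]; simp)
  have hne : U' ≠ ⊥ := by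
    rintro rfl
    rw [finrank_bot] at hU'
    omega
  obtain ⟨x, hx, hx0⟩ := Submodule.exists_mem_ne_zero_of_ne_bot hne
  obtain ⟨_, ⟨u, rfl⟩, h1, h2, h3, h4⟩ := hlift x hx
  have := hiso₀ u u
  rw [he] at this
  simp only [bval, Fintype.sum_sum_type, Sum.elim_inl, Sum.elim_inr, Pi.smul_apply, h1, h2, h3, h4,
    hypPlanes] at this
  obtain ⟨hl, hr'⟩ := eq_zero_of_qval_eq hr hf₁ (u := x ∘ Sum.inl) (w := x ∘ Sum.inr) (by
    simp only [qval, Function.comp_apply, smul_eq_mul, neg_mul, mul_assoc, Finset.sum_neg_distrib,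
      ← Finset.mul_sum] at this ⊢
    simp only [pow_two]
    linear_combination this)
  refine hx0 (funext fun i => ?_)
  rcases i with i | i
  exacts [congrFun hl i, congrFun hr' i]

end Residue

end QF

namespace QF

open Matrix QuadraticAlgebra

section QuadraticExtension

variable {E : Type*} [Field E]

theorem bval_re {ι : Type} [Fintype ι] (g : E) (e : ι → E) (u v : ι → QuadraticAlgebra E g 0) :
    (bval (fun i => algebraMap E (QuadraticAlgebra E g 0) (e i)) u v).re =
      bval e (fun i => (u i).re) (fun i => (v i).re) +
        g * bval e (fun i => (u i).im) (fun i => (v i).im) := by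
  have hre (f : ι → QuadraticAlgebra E g 0) : (∑ i, f i).re = ∑ i, (f i).re :=
    map_sum (AddMonoidHom.mk' QuadraticAlgebra.re fun _ _ => rfl) _ _
  simp only [bval, hre, Finset.mul_sum, ← Finset.sum_add_distrib]
  exact Finset.sum_congr rfl fun i _ => by simp; ring

theorem bval_im {ι : Type} [Fintype ι] (g : E) (e : ι → E) (u v : ι → QuadraticAlgebra E g 0) :
    (bval (fun i => algebraMap E (QuadraticAlgebra E g 0) (e i)) u v).im =
      bval e (fun i => (u i).re) (fun i => (v i).im) +
        bval e (fun i => (u i).im) (fun i => (v i).re) := by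
  have him (f : ι → QuadraticAlgebra E g 0) : (∑ i, f i).im = ∑ i, (f i).im :=
    map_sum (AddMonoidHom.mk' QuadraticAlgebra.im fun _ _ => rfl) _ _
  simp only [bval, him, ← Finset.sum_add_distrib]
  exact Finset.sum_congr rfl fun i _ => by simp

/-- A large space of pairs `(u, w)` with `u + √g w` isotropic for the anisotropic form `r` gives
an endomorphism of `r` with multiplier `x² - g`. -/
theorem hasFactor_of_isotropic_pairs (h2 : (2 : E) ≠ 0) {m : ℕ} {r : Fin m → E}
    (hr : ∀ v, qval r v = 0 → v = 0) (g : E) (U : Submodule E (Fin m ⊕ Fin m → E))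
    (hU : m ≤ Module.finrank E U)
    (hre : ∀ x ∈ U, qval r (x ∘ Sum.inl) + g * qval r (x ∘ Sum.inr) = 0)
    (him : ∀ x ∈ U, bval r (x ∘ Sum.inl) (x ∘ Sum.inr) = 0) (x : E) :
    HasFactor r (x ^ 2 - g) := by
  let π : U →ₗ[E] (Fin m → E) := (LinearMap.funLeft E E Sum.inr).comp U.subtype
  let ρ : U →ₗ[E] (Fin m → E) := (LinearMap.funLeft E E Sum.inl).comp U.subtype
  have hπ : Function.Injective π := by
    rw [injective_iff_map_eq_zero]
    intro u hu
    have h1 : (u : Fin m ⊕ Fin m → E) ∘ Sum.inr = 0 := hu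
    have h3 := hre u u.2
    rw [h1, show qval r 0 = 0 by simp [qval], mul_zero, add_zero] at h3
    have h4 := hr _ h3
    ext i
    rcases i with i | i
    exacts [congrFun h4 i, congrFun h1 i]
  have hdim : Module.finrank E U = Module.finrank E (Fin m → E) :=
    le_antisymm (LinearMap.finrank_le_finrank_of_injective hπ) (by simpa using hU)
  let φ := LinearEquiv.ofInjectiveOfFinrankEq π hπ hdim
  have hφ (u) : φ u = π u := rfl
  let J : (Fin m → E) →ₗ[E] (Fin m → E) := ρ.comp φ.symm.toLinearMap
  refine ⟨LinearMap.toMatrix' (x • LinearMap.id + J), gram_of_qval (IsUnit.mk0 _ h2) fun w => ?_⟩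
  obtain ⟨u, rfl⟩ := φ.surjective w
  have hJ : J (φ u) = ρ u := by simp [J]
  have h1 := hre u u.2
  have h3 := him u u.2
  rw [LinearMap.toMatrix'_mulVec, LinearMap.add_apply, LinearMap.smul_apply, LinearMap.id_apply,
    hJ, qval_add, qval_smul, bval_comm, bval_smul_right, hφ]
  change _ ^ 2 * qval r ((u : Fin m ⊕ Fin m → E) ∘ Sum.inr) + qval r (u.1 ∘ Sum.inl) +
    2 * (_ * bval r (u.1 ∘ Sum.inl) (u.1 ∘ Sum.inr)) = _ * qval r (u.1 ∘ Sum.inr)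
  rw [h3]
  linear_combination h1

/-- If `q` becomes hyperbolic over `E[√g]`, then all norms `x² - g` are similarity factors. -/
theorem hasFactor_of_hyp_quadraticAlgebra (h2 : (2 : E) ≠ 0) {g : E} (hg : g ≠ 0) {ι : Type}
    [Fintype ι] [DecidableEq ι] {q : ι → E} (hq : ∀ i, q i ≠ 0)
    (h : Hyp (fun i => algebraMap E (QuadraticAlgebra E g 0) (q i))) (x : E) :
    HasFactor q (x ^ 2 - g) := by
  obtain ⟨m, k, r, hr, hiso⟩ := exists_witt_decomposition_of_fintype h2 q hq
  have h2h : (2 : E) * 2⁻¹ = 1 := mul_inv_cancel₀ h2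
  refine HasFactor.of_iso hiso (HasFactor.sum ?_ (hasFactor_hypPlanes h2h _))
  set e := Sum.elim r (hypPlanes E (Fin k)) with he
  obtain ⟨k', hk'⟩ := Hyp.of_iso (hiso.map (algebraMap E (QuadraticAlgebra E g 0))).symm h
  have hcard := hk'.card_eq
  simp only [Fintype.card_sum, Fintype.card_fin] at hcard
  obtain ⟨N, M, hMN, -, hN⟩ := hk'.symm
  let c : (Fin k' → QuadraticAlgebra E g 0) → (Fin m ⊕ (Fin k ⊕ Fin k) → QuadraticAlgebra E g 0) :=
    fun z => N *ᵥ (Sum.elim z z)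
  have hc (z z') : bval (fun i => algebraMap E (QuadraticAlgebra E g 0) (e i)) (c z) (c z') =
      0 := by
    rw [bval_mulVec (by rw [hN, one_smul] : _ = (1 : QuadraticAlgebra E g 0) • _)]
    simp [bval, hypPlanes, Fintype.sum_sum_type, Finset.sum_neg_distrib]
  let Ψ : (Fin k' → QuadraticAlgebra E g 0) →ₗ[E]
      ((Fin m ⊕ (Fin k ⊕ Fin k)) ⊕ (Fin m ⊕ (Fin k ⊕ Fin k)) → E) :=
    { toFun := fun z => Sum.elim (fun i => (c z i).re) (fun i => (c z i).im)
      map_add' := fun z z' => by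
        have : c (z + z') = c z + c z' := by
          simp only [c]; rw [← mulVec_add, Sum.elim_add_add]
        ext i
        rcases i with i | i <;> simp [this]
      map_smul' := fun a z => by
        have : c (a • z) = a • c z := by
          simp only [c]; rw [← mulVec_smul]; congr 1; ext i <;> rcases i with i | i <;> rfl
        ext i
        rcases i with i | i <;> simp [this] }
  have hΨ : Function.Injective Ψ := by
    intro z z' hzz
    have hcz : c z = c z' := by
      ext i
      exacts [congrFun hzz (Sum.inl i), congrFun hzz (Sum.inr i)]
    have := congrArg (fun v => M *ᵥ v) hcz
    simp only [c, mulVec_mulVec, hMN, one_mulVec] at this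
    exact funext fun i => congrFun this (Sum.inl i)
  have hfin : Module.finrank E (Fin k' → QuadraticAlgebra E g 0) = k' + k' := by
    rw [Module.finrank_pi_fintype]
    simp [QuadraticAlgebra.finrank_eq_two, mul_two]
  obtain ⟨U, hU, hlift⟩ := exists_large_projection r g hg he (LinearMap.range Ψ)
    (by
      rintro _ ⟨u, rfl⟩ _ ⟨v, rfl⟩
      have := congrArg QuadraticAlgebra.re (hc u v)
      rw [bval_re] at this
      rw [bval_sum_elim]
      refine Eq.trans ?_ this
      simp only [bval, Finset.mul_sum]
      congr 1
      exact Finset.sum_congr rfl fun i _ => by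
        simp only [Pi.smul_apply, smul_eq_mul, mul_assoc]; rfl)
    (by rw [LinearMap.finrank_range_of_inj hΨ, hfin]; omega)
  have hy (x) (hx : x ∈ U) : qval r (x ∘ Sum.inl) + g * qval r (x ∘ Sum.inr) = 0 ∧
      bval r (x ∘ Sum.inl) (x ∘ Sum.inr) = 0 := by
    obtain ⟨_, ⟨z, rfl⟩, h1, h3, h4, h5⟩ := hlift x hx
    have hre := congrArg QuadraticAlgebra.re (hc z z)
    have him := congrArg QuadraticAlgebra.im (hc z z)
    rw [bval_re] at hre
    rw [bval_im, bval_comm _ (fun i => (c z i).im), ← two_mul] at him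
    have him := (mul_eq_zero.mp him).resolve_left h2
    have h1 (i) : (c z (Sum.inl i)).re = x (Sum.inl i) := h1 i
    have h3 (i) : (c z (Sum.inl i)).im = x (Sum.inr i) := h3 i
    have h4 (i) : (c z (Sum.inr (Sum.inl i))).re = (c z (Sum.inr (Sum.inr i))).re := h4 i
    have h5 (i) : (c z (Sum.inr (Sum.inl i))).im = (c z (Sum.inr (Sum.inr i))).im := h5 i
    simp only [bval, he, Fintype.sum_sum_type, Sum.elim_inl, Sum.elim_inr, hypPlanes, h1, h3, h4,
      h5, one_mul, neg_mul, Finset.sum_neg_distrib, add_neg_cancel, add_zero] at hre him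
    rw [← bval_self, ← bval_self]
    exact ⟨hre, him⟩
  exact hasFactor_of_isotropic_pairs h2 hr g U hU (fun x hx => (hy x hx).1)
    (fun x hx => (hy x hx).2) x

end QuadraticExtension

end QF

namespace QF

open Matrix MvPolynomial

section GenericValue

variable {F : Type*} [Field F]

/-- The part of the quadric polynomial not involving the first variable. -/
noncomputable def tailPoly {m : ℕ} (p : Fin (m + 1) → F) : MvPolynomial (Fin m) F :=
  formPoly fun i => p i.succ

theorem formPoly_succ {m : ℕ} (p : Fin (m + 1) → F) :
    formPoly p = C (p 0) * X 0 ^ 2 + rename Fin.succ (tailPoly p) := by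
  simp [formPoly, tailPoly, Fin.sum_univ_succ]

theorem eval_formPoly {n : ℕ} (p v : Fin n → F) : eval v (formPoly p) = qval p v := by
  simp [formPoly, qval]

theorem formPoly_ne_zero {n : ℕ} (hn : 0 < n) {p : Fin n → F} (hp : ∀ i, p i ≠ 0) :
    formPoly p ≠ 0 := by
  intro h
  have := congrArg (eval (Pi.single ⟨0, hn⟩ 1)) h
  simp [eval_formPoly, qval, Pi.single_apply, hp] at this

/-- Modulo the quadric polynomial, every polynomial is linear in the first variable. -/
theorem exists_linear_representative {m : ℕ} {p : Fin (m + 1) → F} (hp : p 0 ≠ 0)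
    (f : MvPolynomial (Fin (m + 1)) F) : ∃ a b : MvPolynomial (Fin m) F,
      Ideal.Quotient.mk (Ideal.span {formPoly p}) f =
        Ideal.Quotient.mk (Ideal.span {formPoly p})
          (rename Fin.succ a + rename Fin.succ b * X 0) := by
  induction f using MvPolynomial.induction_on with
  | C c => exact ⟨C c, 0, by simp⟩
  | add f g hf hg =>
    obtain ⟨a, b, h⟩ := hf
    obtain ⟨a', b', h'⟩ := hg
    refine ⟨a + a', b + b', ?_⟩
    rw [map_add, h, h', ← map_add]
    congr 1
    simp only [map_add]
    ring
  | mul_X f i hf =>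
    obtain ⟨a, b, h⟩ := hf
    rw [map_mul, h, ← map_mul]
    refine Fin.cases ?_ (fun j => ⟨a * X j, b * X j, ?_⟩) i
    · refine ⟨-C (p 0)⁻¹ * tailPoly p * b, a, ?_⟩
      rw [Ideal.Quotient.eq, Ideal.mem_span_singleton, formPoly_succ]
      refine ⟨C (p 0)⁻¹ * rename Fin.succ b, ?_⟩
      have hc : (C (p 0)⁻¹ * C (p 0) : MvPolynomial (Fin (m + 1)) F) = 1 := by
        rw [← C_mul, inv_mul_cancel₀ hp, C_1]
      simp only [map_mul, map_neg, rename_C]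
      linear_combination (-rename Fin.succ b * X 0 ^ 2) * hc
    · congr 1
      simp only [map_mul, rename_X]
      ring

variable {E : Type*} [Field E]

/-- The function field of a quadric of dimension at least two embeds into the quadratic
extension `E[√g]` of the rational function field `E`, with `-g` the tail of the normalized
form. -/
theorem exists_ringHom_quadraticAlgebra {m : ℕ} (hm : 0 < m) {p : Fin (m + 1) → F}
    (hp : ∀ i, p i ≠ 0) [Algebra (MvPolynomial (Fin (m + 1)) F) E]
    [IsFractionRing (MvPolynomial (Fin (m + 1)) F) E] :
    ∃ g : E, g ≠ 0 ∧
      algebraMap (MvPolynomial (Fin (m + 1)) F) E (C (p 0)) ^ 2 *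
        (algebraMap (MvPolynomial (Fin (m + 1)) F) E (X 0) ^ 2 - g) =
        algebraMap (MvPolynomial (Fin (m + 1)) F) E (C (p 0) * formPoly p) ∧
      ∃ θ : FunField p →+* QuadraticAlgebra E g 0, ∀ c : F, θ (algebraMap F (FunField p) c) =
        algebraMap E (QuadraticAlgebra E g 0)
          (algebraMap (MvPolynomial (Fin (m + 1)) F) E (C c)) := by
  have hinj : Function.Injective (algebraMap (MvPolynomial (Fin (m + 1)) F) E) :=
    IsFractionRing.injective _ _
  have hp0 : algebraMap (MvPolynomial (Fin (m + 1)) F) E (C (p 0)) ≠ 0 :=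
    (map_ne_zero_iff _ hinj).mpr (C_ne_zero.mpr (hp 0))
  have hren : Function.Injective (rename Fin.succ : MvPolynomial (Fin m) F →ₐ[F]
    MvPolynomial (Fin (m + 1)) F) := rename_injective _ (Fin.succ_injective _)
  have htail : algebraMap (MvPolynomial (Fin (m + 1)) F) E (rename Fin.succ (tailPoly p)) ≠ 0 :=
    (map_ne_zero_iff _ hinj).mpr
      ((map_ne_zero_iff _ hren).mpr (formPoly_ne_zero hm fun i => hp i.succ))
  obtain ⟨g, hg⟩ : ∃ g : E, algebraMap (MvPolynomial (Fin (m + 1)) F) E (C (p 0)) * g =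
      -algebraMap (MvPolynomial (Fin (m + 1)) F) E (rename Fin.succ (tailPoly p)) :=
    ⟨_, mul_div_cancel₀ _ hp0⟩
  have hg0 : g ≠ 0 := by
    rintro rfl
    rw [mul_zero, eq_comm, neg_eq_zero] at hg
    exact htail hg
  refine ⟨g, hg0, ?_, ?_⟩
  · rw [formPoly_succ]
    simp only [map_mul, map_add, map_pow]
    linear_combination (-algebraMap (MvPolynomial (Fin (m + 1)) F) E (C (p 0))) * hg
  let Φ : MvPolynomial (Fin (m + 1)) F →+* QuadraticAlgebra E g 0 :=
    eval₂Hom ((algebraMap E (QuadraticAlgebra E g 0)).comp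
        ((algebraMap (MvPolynomial (Fin (m + 1)) F) E).comp C))
      (Fin.cons QuadraticAlgebra.omega fun i => algebraMap E (QuadraticAlgebra E g 0)
        (algebraMap (MvPolynomial (Fin (m + 1)) F) E (X i.succ)))
  have hΦC (c : F) : Φ (C c) = algebraMap E (QuadraticAlgebra E g 0)
      (algebraMap (MvPolynomial (Fin (m + 1)) F) E (C c)) := by simp [Φ]
  have hΦX : Φ (X 0) = QuadraticAlgebra.omega := by simp [Φ]
  have hΦren (a : MvPolynomial (Fin m) F) : Φ (rename Fin.succ a) =
      algebraMap E (QuadraticAlgebra E g 0)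
        (algebraMap (MvPolynomial (Fin (m + 1)) F) E (rename Fin.succ a)) := by
    induction a using MvPolynomial.induction_on with
    | C c => rw [rename_C, hΦC]
    | add a b ha hb => simp only [map_add, ha, hb]
    | mul_X a i ha => simp only [map_mul, ha, rename_X]; simp [Φ]
  have hΦlin (a b : MvPolynomial (Fin m) F) : Φ (rename Fin.succ a + rename Fin.succ b * X 0) =
      ⟨algebraMap (MvPolynomial (Fin (m + 1)) F) E (rename Fin.succ a),
        algebraMap (MvPolynomial (Fin (m + 1)) F) E (rename Fin.succ b)⟩ := by
    rw [map_add, map_mul, hΦren, hΦren, hΦX]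
    ext <;> simp
  have hΦp : Φ (formPoly p) = 0 := by
    rw [formPoly_succ, map_add, map_mul, map_pow, hΦC, hΦX, hΦren]
    ext
    · simp [pow_two, hg]
    · simp [pow_two]
  have hker : ∀ f ∈ Ideal.span {formPoly p}, Φ f = 0 := by
    intro f hf
    obtain ⟨c, rfl⟩ := Ideal.mem_span_singleton.mp hf
    rw [map_mul, hΦp, zero_mul]
  let Φ' : CoordRing p →+* QuadraticAlgebra E g 0 := Ideal.Quotient.lift _ Φ hker
  have hΦ' (f) : Φ' (Ideal.Quotient.mk _ f) = Φ f := Ideal.Quotient.lift_mk _ _ _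
  have hunit (y : nonZeroDivisors (CoordRing p)) : IsUnit (Φ' y) := by
    obtain ⟨y, hy⟩ := y
    obtain ⟨f, rfl⟩ := Ideal.Quotient.mk_surjective y
    obtain ⟨a, b, hab⟩ := exists_linear_representative (hp 0) f
    simp only [hab] at hy ⊢
    rw [hΦ', hΦlin, QuadraticAlgebra.isUnit_iff_norm_isUnit, isUnit_iff_ne_zero,
      QuadraticAlgebra.norm_def]
    intro hnorm
    have hrel : C (p 0) * rename Fin.succ a ^ 2 +
        rename Fin.succ (tailPoly p) * rename Fin.succ b ^ 2 = 0 := by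
      apply hinj
      simp only [map_add, map_mul, map_pow, map_zero]
      linear_combination algebraMap (MvPolynomial (Fin (m + 1)) F) E (C (p 0)) * hnorm +
        algebraMap (MvPolynomial (Fin (m + 1)) F) E (rename Fin.succ b) ^ 2 * hg
    have hconj : Ideal.Quotient.mk (Ideal.span {formPoly p})
        (C (p 0) * (rename Fin.succ a - rename Fin.succ b * X 0)) = 0 := by
      refine (mul_right_mem_nonZeroDivisors_eq_zero_iff hy).mp ?_
      rw [← map_mul, Ideal.Quotient.eq_zero_iff_mem, Ideal.mem_span_singleton, formPoly_succ]
      exact ⟨-rename Fin.succ b ^ 2, by linear_combination hrel⟩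
    have h0 := congrArg Φ' hconj
    rw [map_zero, hΦ', map_mul, hΦC, sub_eq_add_neg, ← neg_mul, ← map_neg, hΦlin] at h0
    have hre := congrArg QuadraticAlgebra.re h0
    have him := congrArg QuadraticAlgebra.im h0
    simp only [QuadraticAlgebra.re_mul, QuadraticAlgebra.im_mul, QuadraticAlgebra.algebraMap_re,
      QuadraticAlgebra.algebraMap_im, mul_zero, zero_mul, add_zero, QuadraticAlgebra.re_zero,
      QuadraticAlgebra.im_zero, mul_eq_zero, hp0, false_or, map_neg, neg_eq_zero,
      map_eq_zero_iff _ hinj] at hre him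
    rw [hre, him, zero_mul, add_zero, map_zero] at hy
    have h1 : (1 : CoordRing p) = 0 := by
      have := (mul_right_mem_nonZeroDivisors_eq_zero_iff hy (x := 1)).mp (mul_zero 1)
      exact this
    have h1 := congrArg (fun y => (Φ' y).re) h1
    simp only [map_one, map_zero] at h1
    exact one_ne_zero (α := E) h1
  refine ⟨IsLocalization.lift hunit, fun c => ?_⟩
  rw [IsScalarTower.algebraMap_apply F (CoordRing p) (FunField p), IsLocalization.lift_eq,
    ← hΦC, ← hΦ']
  rfl

theorem exists_hasFactor_formPoly (h2 : (2 : F) ≠ 0) {m : ℕ} (hm : 0 < m) {p : Fin (m + 1) → F}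
    (hp : ∀ i, p i ≠ 0) {ι : Type} [Fintype ι] [DecidableEq ι] {q : ι → F} (hq : ∀ i, q i ≠ 0)
    (h : Hyp (fun i => algebraMap F (FunField p) (q i))) :
    ∃ s : MvPolynomial (Fin (m + 1)) F, s ≠ 0 ∧
      HasFactor (fun i => (C (q i) : MvPolynomial (Fin (m + 1)) F))
        (s ^ 2 * (C (p 0) * formPoly p)) := by
  obtain ⟨E, _, _, _⟩ : ∃ (E : Type _) (_ : Field E) (_ : Algebra (MvPolynomial (Fin (m + 1)) F) E),
      IsFractionRing (MvPolynomial (Fin (m + 1)) F) E :=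
    ⟨FractionRing (MvPolynomial (Fin (m + 1)) F), inferInstance, inferInstance, inferInstance⟩
  have hinj : Function.Injective (algebraMap (MvPolynomial (Fin (m + 1)) F) E) :=
    IsFractionRing.injective _ _
  have hne {c : F} (hc : c ≠ 0) : algebraMap (MvPolynomial (Fin (m + 1)) F) E (C c) ≠ 0 :=
    (map_ne_zero_iff _ hinj).mpr (C_ne_zero.mpr hc)
  obtain ⟨g, hg, hx, θ, hθ⟩ := exists_ringHom_quadraticAlgebra (E := E) hm hp
  have h2E : (2 : E) ≠ 0 := by have := hne h2; rwa [map_ofNat, map_ofNat] at this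
  have hL := h.map θ
  simp only [hθ] at hL
  have hfac := (hasFactor_sq _ (algebraMap (MvPolynomial (Fin (m + 1)) F) E (C (p 0)))).mul
    (hasFactor_of_hyp_quadraticAlgebra h2E hg (fun i => hne (hq i)) hL
      (algebraMap (MvPolynomial (Fin (m + 1)) F) E (X 0)))
  rw [hx] at hfac
  obtain ⟨T, hT⟩ := hfac
  obtain ⟨b, hb⟩ := IsLocalization.exist_integer_multiples_of_finite
    (nonZeroDivisors (MvPolynomial (Fin (m + 1)) F)) (fun ij : ι × ι => T ij.1 ij.2)
  choose S hS using hb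
  refine ⟨b, nonZeroDivisors.coe_ne_zero b, Matrix.of fun i j => S (i, j), ?_⟩
  have hST : (Matrix.of fun i j => S (i, j)).map (algebraMap _ E) =
      algebraMap (MvPolynomial (Fin (m + 1)) F) E b • T := by
    ext i j
    simpa [Algebra.smul_def] using hS (i, j)
  have hinj' : Function.Injective fun A : Matrix ι ι (MvPolynomial (Fin (m + 1)) F) =>
      A.map (algebraMap _ E) := Matrix.map_injective hinj
  apply hinj'
  have hd (α : MvPolynomial (Fin (m + 1)) F) :
      (α • diagonal fun i => (C (q i) : MvPolynomial (Fin (m + 1)) F)).map (algebraMap _ E) =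
      algebraMap _ E α •
        diagonal fun i => algebraMap (MvPolynomial (Fin (m + 1)) F) E (C (q i)) := by
    ext i j; by_cases hij : i = j <;> simp [hij]
  have hd1 := hd 1
  rw [one_smul, map_one, one_smul] at hd1
  simp only [Matrix.map_mul, transpose_map, hST, hd, hd1]
  rw [transpose_smul, Matrix.smul_mul, Matrix.smul_mul, Matrix.mul_smul, hT, smul_smul, smul_smul]
  congr 1
  simp only [map_mul, map_pow]
  ring

end GenericValue

end QF

namespace QF

open Matrix

section Degeneration

variable {F : Type*} [Field F] {K : Type*} [Field K]

open Polynomial in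
/-- A nonzero polynomial over `F` does not vanish at a suitable polynomial curve over `K` with
prescribed initial terms. -/
theorem exists_eval₂_ne_zero {k : ℕ} (φ : F →+* K) {s : MvPolynomial (Fin k) F} (hs : s ≠ 0)
    (b : Fin k → K[X]) {c : K[X]} (hc : c ≠ 0) :
    ∃ y : Fin k → K[X],
      MvPolynomial.eval₂ ((C : K →+* K[X]).comp φ) (fun i => b i + c * y i) s ≠ 0 := by
  by_contra! h
  have hφ : Function.Injective ((C : K →+* K[X]).comp φ) := RingHom.injective _
  refine hs (MvPolynomial.map_injective _ hφ ?_)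
  rw [map_zero]
  refine MvPolynomial.funext_set (fun i => Set.range fun y => b i + c * y) (fun i => ?_)
    fun x hx => ?_
  · exact Set.infinite_range_of_injective fun y y' hy => mul_left_cancel₀ hc (add_left_cancel hy)
  · choose y hy using fun i => hx i (Set.mem_univ i)
    obtain rfl : (fun i => b i + c * y i) = x := funext hy
    rw [MvPolynomial.eval_map, h, map_zero]

theorem pfisterCoeff_map {R S : Type*} [CommRing R] [CommRing S] (f : R →+* S) {n : ℕ}
    (a : Fin n → R) (j : Fin n → Fin 2) :
    pfisterCoeff (fun i => f (a i)) j = f (pfisterCoeff a j) := by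
  simp only [pfisterCoeff, map_prod]
  exact Finset.prod_congr rfl fun i _ => by split_ifs <;> simp

open Polynomial in
/-- If `q` is hyperbolic over the function field of `p`, then `π ⊗ q` is hyperbolic over every
field over which `π ⊗ p` is isotropic. -/
theorem hyp_of_isotropic (h2 : (2 : F) ≠ 0) {m : ℕ} (hm : 0 < m) {p : Fin (m + 1) → F}
    (hp : ∀ i, p i ≠ 0) {ι : Type} [Fintype ι] [DecidableEq ι] {q : ι → F} (hq : ∀ i, q i ≠ 0)
    (hhyp : Hyp (fun i => algebraMap F (FunField p) (q i))) {n : ℕ} {a : Fin n → F}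
    (ha : ∀ i, a i ≠ 0) (φ : F →+* K) {v : (Fin n → Fin 2) × Fin (m + 1) → K} (hv : v ≠ 0)
    (hiso : qval (fun x => φ (formMul (pfisterCoeff a) p x)) v = 0) :
    Hyp (fun x => φ (formMul (pfisterCoeff a) q x)) := by
  have h2K : (2 : K) ≠ 0 := by
    have := (map_ne_zero φ).mpr h2
    rwa [map_ofNat] at this
  have hd {κ : Type} {r : κ → F} (hr : ∀ i, r i ≠ 0) (x) :
      φ (formMul (pfisterCoeff a) r x) ≠ 0 :=
    (map_ne_zero φ).mpr (mul_ne_zero (pfisterCoeff_ne_zero ha _) (hr _))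
  obtain ⟨s, hs, hfac⟩ := exists_hasFactor_formPoly h2 hm hp hq hhyp
  obtain ⟨x₀, hx₀⟩ := Function.ne_iff.mp hv
  choose y hy using fun j : Fin n → Fin 2 => exists_eval₂_ne_zero φ hs
    (fun i => C (v (j, i)) + X * (Pi.single x₀ 1 : _ → K[X]) (j, i)) (c := X ^ 2)
    (pow_ne_zero 2 X_ne_zero)
  let u : (Fin n → Fin 2) × Fin (m + 1) → K[X] := Pi.single x₀ 1 + (X : K[X]) • fun x => y x.1 x.2
  let z : (Fin n → Fin 2) × Fin (m + 1) → K[X] := (fun x => C (v x)) + (X : K[X]) • u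
  let d : (Fin n → Fin 2) × Fin (m + 1) → K[X] :=
    fun x => C (φ (formMul (pfisterCoeff a) p x))
  let f₁ : K[X] := C (φ (p 0)) * (X * qval d u + 2 * bval d (fun x => C (v x)) u)
  have hz : C (φ (p 0)) * qval d z = X * f₁ := by
    have h0 : qval d (fun x => C (v x)) = 0 := by
      simpa [qval, d] using congrArg C hiso
    simp only [z, f₁, qval_add, qval_smul, bval_smul_right, h0]
    ring
  have hf₁ : f₁.eval 0 ≠ 0 := by
    have : f₁.eval 0 = φ (p 0) * (2 * (φ (formMul (pfisterCoeff a) p x₀) * v x₀)) := by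
      simp only [f₁, u, bval_add_right, bval_smul_right, bval_single]
      simp [d]
    rw [this]
    exact mul_ne_zero ((map_ne_zero φ).mpr (hp 0))
      (mul_ne_zero h2K (mul_ne_zero (hd hp x₀) hx₀))
  obtain ⟨E, _, _, _⟩ : ∃ (E : Type _) (_ : Field E) (_ : Algebra K[X] E), IsFractionRing K[X] E :=
    ⟨FractionRing K[X], inferInstance, inferInstance, inferInstance⟩
  have hinj : Function.Injective (algebraMap K[X] E) := IsFractionRing.injective _ _
  let ψ : F →+* E := (algebraMap K[X] E).comp ((C : K →+* K[X]).comp φ)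
  have hψ (c : F) : ψ c = algebraMap K[X] E (C (φ c)) := rfl
  have hψ0 {c : F} (hc : c ≠ 0) : ψ c ≠ 0 := (map_ne_zero ψ).mpr hc
  let α (j : Fin n → Fin 2) : E := algebraMap K[X] E
    (C (φ (p 0)) * qval (fun i => C (φ (p i))) fun i => z (j, i))
  have hα (j) : HasFactor (fun i => ψ (q i)) (α j) := by
    let χ := (algebraMap K[X] E).comp
      (MvPolynomial.eval₂Hom ((C : K →+* K[X]).comp φ) fun i => z (j, i))
    have hχs : χ s ≠ 0 := by
      have hzj : (fun i => z (j, i)) = fun i => C (v (j, i)) +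
          X * (Pi.single x₀ 1 : _ → K[X]) (j, i) + X ^ 2 * y j i := by
        funext i
        simp only [z, u, Pi.add_apply, Pi.smul_apply, smul_eq_mul]
        ring
      refine (map_ne_zero_iff _ hinj).mpr ?_
      rw [hzj]
      exact hy j
    have h := hfac.map χ
    rw [map_mul, map_pow] at h
    have h := HasFactor.of_sq_mul hχs h
    convert h using 1
    · ext i
      simp [χ, ψ]
    · simp [χ, α, formPoly, qval]
  have hsum : ∑ j, pfisterCoeff (fun i => ψ (a i)) j * α j = algebraMap K[X] E (X * f₁) := by
    rw [← hz]
    simp only [α, pfisterCoeff_map, hψ, ← map_mul, ← map_sum]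
    congr 1
    simp only [qval, d, formMul, Finset.mul_sum, Fintype.sum_prod_type, map_mul]
    exact Finset.sum_congr rfl fun j _ => Finset.sum_congr rfl fun i _ => by ring
  refine hyp_of_hasFactor (E := E) h2K (hd hq) hf₁ ?_
  rw [← hsum]
  convert HasFactor.pfister (fun i => hψ0 (hq i)) (fun i => ψ (a i)) (fun i => hψ0 (ha i)) α hα
    using 1
  ext x
  simp only [formMul, pfisterCoeff_map, map_mul, hψ]

end Degeneration

end QF

namespace QF

open Matrix MvPolynomial

section FunctionField

variable {F : Type*} [Field F]

/-- The degree one coefficient of a polynomial along lines through the origin is a linear form in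
the direction. -/
theorem exists_coeff_one_aeval_line {N : ℕ} (f : MvPolynomial (Fin N) F) :
    ∃ c : Fin N → F, ∀ v : Fin N → F,
      (aeval (fun i => Polynomial.C (v i) * Polynomial.X) f).coeff 1 = ∑ i, c i * v i := by
  have h0 (v : Fin N → F) (f : MvPolynomial (Fin N) F) :
      (aeval (fun i => Polynomial.C (v i) * Polynomial.X) f).coeff 0 = constantCoeff f := by
    induction f using MvPolynomial.induction_on with
    | C a => simp
    | add f g hf hg => simp only [map_add, Polynomial.coeff_add, hf, hg]
    | mul_X f i _ => simp
  induction f using MvPolynomial.induction_on with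
  | C a => exact ⟨0, fun v => by simp⟩
  | add f g hf hg =>
    obtain ⟨c, hc⟩ := hf
    obtain ⟨c', hc'⟩ := hg
    exact ⟨c + c', fun v => by simp [hc, hc', add_mul, Finset.sum_add_distrib]⟩
  | mul_X f i _ =>
    refine ⟨Pi.single i (constantCoeff f), fun v => ?_⟩
    rw [map_mul, aeval_X, ← mul_assoc, Polynomial.coeff_mul_X, Polynomial.coeff_mul_C, h0]
    simp [Pi.single_apply]

theorem exists_ne_zero_sum_mul_eq_zero {N : ℕ} (hN : 2 ≤ N) (c : Fin N → F) :
    ∃ v : Fin N → F, v ≠ 0 ∧ ∑ i, c i * v i = 0 := by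
  let i₀ : Fin N := ⟨0, by omega⟩
  let i₁ : Fin N := ⟨1, by omega⟩
  have h01 : i₀ ≠ i₁ := by simp [i₀, i₁]
  by_cases h : c i₀ = 0
  · exact ⟨Pi.single i₀ 1, by simp, by simp [Pi.single_apply, h]⟩
  · refine ⟨Pi.single i₀ (-c i₁) + Pi.single i₁ (c i₀), fun h0 => h ?_, ?_⟩
    · simpa [h01.symm] using congrFun h0 i₁
    · simp only [Pi.add_apply, mul_add, Finset.sum_add_distrib, Pi.single_apply, mul_ite, mul_zero,
        Finset.sum_ite_eq', Finset.mem_univ, if_true]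
      ring

theorem isHomogeneous_formPoly {N : ℕ} (d : Fin N → F) : (formPoly d).IsHomogeneous 2 :=
  IsHomogeneous.sum _ _ _ fun i _ => by
    simpa using (isHomogeneous_C (Fin N) (d i)).mul (isHomogeneous_X_pow i 2)

/-- The quadric polynomial of an anisotropic form of dimension at least two is irreducible. -/
theorem irreducible_formPoly {N : ℕ} (hN : 2 ≤ N) {d : Fin N → F}
    (hd : ∀ v, qval d v = 0 → v = 0) : Irreducible (formPoly d) := by
  have hne : formPoly d ≠ 0 := by
    refine formPoly_ne_zero (by omega) fun i hi => ?_
    have := hd (Pi.single i 1) (by simp [qval, Pi.single_apply, hi])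
    simp at this
  refine ⟨fun h => ?_, fun a b hab => ?_⟩
  · have h0 : IsUnit (eval (0 : Fin N → F) (formPoly d)) := h.map _
    rw [eval_formPoly] at h0
    simp [qval] at h0
  have hab0 : a * b ≠ 0 := hab ▸ hne
  obtain ⟨ha0, hb0⟩ := mul_ne_zero_iff.mp hab0
  have hunit {f : MvPolynomial (Fin N) F} (hf : f ≠ 0) (h : f.totalDegree = 0) : IsUnit f := by
    rw [totalDegree_eq_zero_iff_eq_C] at h
    rw [h] at hf ⊢
    exact (isUnit_iff_ne_zero.mpr fun h => hf (by rw [h, C_0])).map C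
  by_contra! hu
  have ha := mt (hunit ha0) hu.1
  have hb := mt (hunit hb0) hu.2
  have hdeg := (isHomogeneous_formPoly d).totalDegree_le
  rw [hab, totalDegree_mul_of_isDomain ha0 hb0] at hdeg
  obtain ⟨c, hc⟩ := exists_coeff_one_aeval_line a
  obtain ⟨v, hv, hcv⟩ := exists_ne_zero_sum_mul_eq_zero hN c
  refine hv (hd v ?_)
  have hline {f : MvPolynomial (Fin N) F} (hf : f.totalDegree ≤ 1) :
      (aeval (fun i => Polynomial.C (v i) * Polynomial.X) f).natDegree ≤ 1 := by
    simpa using aeval_natDegree_le f hf (fun i => Polynomial.C (v i) * Polynomial.X)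
      fun i => (Polynomial.natDegree_C_mul_le _ _).trans Polynomial.natDegree_X_le
  have hadeg : (aeval (fun i => Polynomial.C (v i) * Polynomial.X) a).natDegree ≤ 0 := by
    rw [Polynomial.natDegree_le_iff_coeff_eq_zero]
    intro k hk
    obtain rfl | hk := Nat.eq_or_lt_of_le hk
    · exact (hc v).trans hcv
    · exact Polynomial.coeff_eq_zero_of_natDegree_lt ((hline (by omega)).trans_lt hk)
  have hmul := congrArg (fun f =>
    (aeval (fun i => Polynomial.C (v i) * Polynomial.X) f).coeff 2) hab
  simp only [map_mul (aeval _) a b] at hmul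
  rw [Polynomial.coeff_eq_zero_of_natDegree_lt (p := _ * _) ((Polynomial.natDegree_mul_le.trans
    (add_le_add hadeg (hline (f := b) (by omega)))).trans_lt (by norm_num))] at hmul
  rw [← hmul]
  simp only [formPoly, qval, map_sum, map_mul, map_pow (aeval _), aeval_X, aeval_C,
    Polynomial.finsetSum_coeff, mul_pow]
  simp only [← Polynomial.C_pow, Polynomial.algebraMap_eq, Polynomial.coeff_C_mul,
    Polynomial.coeff_X_pow, if_true, mul_one]

/-- An anisotropic form of dimension at least two becomes isotropic over its function field, which
is a field. -/
theorem isField_funField {N : ℕ} (hN : 2 ≤ N) {d : Fin N → F}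
    (hd : ∀ v, qval d v = 0 → v = 0) : IsField (FunField d) ∧
      ∃ v : Fin N → FunField d, v ≠ 0 ∧ qval (fun i => algebraMap F (FunField d) (d i)) v = 0 := by
  have hirr := irreducible_formPoly hN hd
  have : (Ideal.span {formPoly d}).IsPrime :=
    (Ideal.span_singleton_prime hirr.ne_zero).mpr hirr.prime
  have : IsDomain (CoordRing d) := Ideal.Quotient.isDomain _
  have hinj : Function.Injective (algebraMap (CoordRing d) (FunField d)) :=
    IsFractionRing.injective _ _
  refine ⟨Field.toIsField (FractionRing (CoordRing d)),
    fun i => algebraMap (CoordRing d) (FunField d) (Ideal.Quotient.mk _ (X i)), fun h => ?_, ?_⟩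
  · have h0 := congrFun h ⟨0, by omega⟩
    rw [Pi.zero_apply, map_eq_zero_iff _ hinj, Ideal.Quotient.eq_zero_iff_mem,
      Ideal.mem_span_singleton] at h0
    have h1 := totalDegree_le_of_dvd_of_isDomain h0 (X_ne_zero _)
    rw [(isHomogeneous_formPoly d).totalDegree hirr.ne_zero, totalDegree_X] at h1
    omega
  · let g := (algebraMap (CoordRing d) (FunField d)).comp (Ideal.Quotient.mk _)
    have hg : g (formPoly d) = 0 := by
      rw [RingHom.comp_apply,
        Ideal.Quotient.eq_zero_iff_mem.mpr (Ideal.mem_span_singleton_self _), map_zero]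
    have hsum : g (formPoly d) = ∑ i, g (C (d i)) * g (X i) ^ 2 := by
      refine (map_sum g _ _).trans (Finset.sum_congr rfl fun i _ => ?_)
      rw [map_mul, map_pow]
    exact hsum.symm.trans hg

/-- The function field of a one-dimensional form specializes to the base field. -/
theorem exists_ringHom_of_dim_one {p : Fin 1 → F} (hp0 : p 0 ≠ 0) :
    ∃ θ : FunField p →+* F, ∀ c, θ (algebraMap F (FunField p) c) = c := by
  have hp : formPoly p = C (p 0) * X 0 ^ 2 := by simp [formPoly]
  have hdecomp (f : MvPolynomial (Fin 1) F) : ∃ g, f = C (eval 0 f) + X 0 * g := by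
    induction f using MvPolynomial.induction_on with
    | C a => exact ⟨0, by simp⟩
    | add f g hf hg =>
      obtain ⟨a, ha⟩ := hf
      obtain ⟨b, hb⟩ := hg
      refine ⟨a + b, ?_⟩
      rw [map_add, C_add]
      linear_combination ha + hb
    | mul_X f i _ => exact ⟨f, by rw [Subsingleton.elim i 0]; simp [mul_comm]⟩
  have hker : ∀ f ∈ Ideal.span {formPoly p}, eval (0 : Fin 1 → F) f = 0 := by
    intro f hf
    obtain ⟨c, rfl⟩ := Ideal.mem_span_singleton.mp hf
    simp [hp]
  let Φ : CoordRing p →+* F := Ideal.Quotient.lift _ (eval 0) hker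
  have hΦ (f) : Φ (Ideal.Quotient.mk _ f) = eval 0 f := Ideal.Quotient.lift_mk _ _ _
  have hX : Ideal.Quotient.mk (Ideal.span {formPoly p}) (X 0) ≠ 0 := by
    rw [Ne, Ideal.Quotient.eq_zero_iff_mem, Ideal.mem_span_singleton]
    rintro ⟨c, hc⟩
    have h1 : (1 : MvPolynomial (Fin 1) F) = C (p 0) * X 0 * c := by
      refine mul_left_cancel₀ (X_ne_zero (0 : Fin 1)) ?_
      rw [hp] at hc
      linear_combination hc
    simpa using congrArg (eval (0 : Fin 1 → F)) h1
  have hunit (y : nonZeroDivisors (CoordRing p)) : IsUnit (Φ y) := by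
    obtain ⟨y, hy⟩ := y
    obtain ⟨f, rfl⟩ := Ideal.Quotient.mk_surjective y
    rw [isUnit_iff_ne_zero, hΦ]
    intro h0
    obtain ⟨g, hg⟩ := hdecomp f
    rw [h0, C_0, zero_add] at hg
    refine hX ((mul_left_mem_nonZeroDivisors_eq_zero_iff hy).mp ?_)
    rw [← map_mul, Ideal.Quotient.eq_zero_iff_mem, Ideal.mem_span_singleton, hp, hg]
    have hc : (C (p 0) * C (p 0)⁻¹ : MvPolynomial (Fin 1) F) = 1 := by
      rw [← C_mul, mul_inv_cancel₀ hp0, C_1]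
    exact ⟨C (p 0)⁻¹ * g, by linear_combination (-X 0 ^ 2 * g) * hc⟩
  refine ⟨IsLocalization.lift hunit, fun c => ?_⟩
  rw [IsScalarTower.algebraMap_apply F (CoordRing p) (FunField p), IsLocalization.lift_eq]
  exact (hΦ (C c)).trans (eval_C c)

end FunctionField

end QF

namespace QF

open Matrix

theorem FormIso.exists_isotropic {R : Type*} [CommRing R] {ι κ : Type} [Fintype ι] [Fintype κ]
    [DecidableEq ι] [DecidableEq κ] {d : ι → R} {e : κ → R} (h : FormIso d e)
    (hd : ∃ v, v ≠ 0 ∧ qval d v = 0) : ∃ v, v ≠ 0 ∧ qval e v = 0 := by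
  obtain ⟨M, N, h1, -, h3⟩ := h
  obtain ⟨v, hv, hqv⟩ := hd
  refine ⟨M *ᵥ v, fun h0 => hv ?_, ?_⟩
  · rw [← one_mulVec v, ← h1, ← mulVec_mulVec, h0, mulVec_zero]
  · rw [qval_mulVec (α := 1) (by rw [h3, one_smul]), hqv, mul_zero]

end QF
open QF in
/-- Fitzgerald's theorem: if `p`, `q` are forms over `F` (char `F ≠ 2`), `π` is an `n`-fold
Pfister form over `F` and `q` is hyperbolic over `F(p)`, then `π ⊗ q` is hyperbolic over
`F(π ⊗ p)`. -/
theorem stmt_9 {F : Type*} [Field F] (h2 : (2 : F) ≠ 0)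
    {np nq mπ : ℕ} (p : Fin np → F) (q : Fin nq → F) (π : Fin mπ → F)
    (hp : Nondeg p) (hq : Nondeg q) (hp0 : 0 < np) (hq0 : 0 < nq)
    (n : ℕ) (hπ : IsNPfister n π)
    (hhyp : IsHyperbolic (bc (algebraMap F (FunField p)) q)) :
    IsHyperbolic (bc (algebraMap F (FunField (tensorQF π p))) (tensorQF π q)) := by
  have hunit (R : Type _) [CommRing R] [Algebra F R] : IsUnit (2 : R) := by
    simpa only [map_ofNat] using (isUnit_iff_ne_zero.mpr h2).map (algebraMap F R)
  have h2F : IsUnit (2 : F) := isUnit_iff_ne_zero.mpr h2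
  obtain ⟨a, ha, hπa⟩ := hπ
  have hiso : FormIso π (pfisterCoeff a) := ((formIso_iff_isometric h2F).mpr hπa).trans
    (FormIso.reindex (pfisterCoeff a) finFunctionFinEquiv.symm)
  have hisoq : FormIso (tensorQF π q) (formMul (pfisterCoeff a) q) :=
    (tensorQF_formIso π q).trans (hiso.mul_right q)
  have hisop : FormIso (tensorQF π p) (formMul (pfisterCoeff a) p) :=
    (tensorQF_formIso π p).trans (hiso.mul_right p)
  have hhyp' : Hyp (fun i => algebraMap F (FunField p) (q i)) :=
    (hyp_iff_isHyperbolic (hunit _)).mpr hhyp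
  refine (hyp_iff_isHyperbolic (hunit _)).mp ?_
  refine Hyp.of_iso (hisoq.map (algebraMap F (FunField (tensorQF π p)))) ?_
  obtain ⟨m, rfl⟩ : ∃ m, np = m + 1 := ⟨np - 1, by omega⟩
  obtain rfl | hm := Nat.eq_zero_or_pos m
  · obtain ⟨θ, hθ⟩ := exists_ringHom_of_dim_one (hp 0)
    have hqF := hhyp'.map θ
    simp only [hθ] at hqF
    exact (Hyp.mul_left (mul_inv_cancel₀ h2) _
      (fun j => isUnit_iff_ne_zero.mpr (pfisterCoeff_ne_zero ha j)) hqF).map _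
  by_cases hanis : ∀ v, qval (tensorQF π p) v = 0 → v = 0
  · have hcard := hiso.card_eq
    have hN : 2 ≤ mπ * (m + 1) := by
      have : 0 < mπ := by
        rw [Fintype.card_fin] at hcard
        exact hcard ▸ Fintype.card_pos
      nlinarith
    obtain ⟨hfield, hv⟩ := isField_funField hN hanis
    let := hfield.toField
    obtain ⟨w, hw, hqw⟩ := (hisop.map (algebraMap F (FunField (tensorQF π p)))).exists_isotropic hv
    exact hyp_of_isotropic h2 hm hp hq hhyp' ha (algebraMap F (FunField (tensorQF π p))) hw hqw
  · push Not at hanis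
    obtain ⟨v, hqv, hv⟩ := hanis
    obtain ⟨w, hw, hqw⟩ := hisop.exists_isotropic ⟨v, hv, hqv⟩
    exact (hyp_of_isotropic h2 hm hp hq hhyp' ha (RingHom.id F) hw hqw).map _
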